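/- Suppose d ≥ 3 is odd. For Φ₂ ∈ 𝒮(ℝ³) set h(ξ) = ∫_{ℝ∖{0}} ∫_ℝ Φ₂(u, (ξ−u²)/t, t) |t|^{(d−5)/2} du dt (an integral converging absolutely for every ξ ≠ 0 and defining a locally integrable function on ℝ). Then: (i) for every Φ ∈ 𝒮(ℝ^d) there exists Φ₂ ∈ 𝒮(ℝ³) such that ∫_{ℝ^d} g(q_d(x)) Φ(x) dx = ∫_ℝ g(ξ) h(ξ) dξ for every continuous compactly supported g : ℝ → ℂ; and (ii) conversely, for every Φ₂ ∈ 𝒮(ℝ³) there exists Φ ∈ 𝒮(ℝ^d) for which the same identity holds. -/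

import Mathlib

open MeasureTheory Filter

noncomputable section

/-- Extension of a vector in `ℝ^d` by zeros, for convenient indexing. -/
def padR {d : ℕ} (x : Fin d → ℝ) (n : ℕ) : ℝ :=
  if h : n < d then x ⟨n, h⟩ else 0

/-- The split quadratic form `q_d` on `ℝ^d`:
`x₁x₂ + x₃x₄ + ⋯ + x_{d−1}x_d` for `d` even, and
`x₁² + x₂x₃ + ⋯ + x_{d−1}x_d` for `d` odd. -/
def splitQR (d : ℕ) (x : Fin d → ℝ) : ℝ :=
  if Even d then ∑ i ∈ Finset.range (d / 2), padR x (2 * i) * padR x (2 * i + 1)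
  else padR x 0 ^ 2 + ∑ i ∈ Finset.range (d / 2), padR x (2 * i + 1) * padR x (2 * i + 2)

/-- The twisted pushforward
`h(ξ) = ∫_{ℝ∖{0}} ∫_ℝ Φ₂(u, (ξ−u²)/t, t) |t|^{(d−5)/2} du dt`. -/
def hThreeR (d : ℕ) (Φ₂ : SchwartzMap (ℝ × ℝ × ℝ) ℂ) (ξ : ℝ) : ℂ :=
  ∫ t in ({0}ᶜ : Set ℝ), ∫ u : ℝ,
    Φ₂ (u, (ξ - u ^ 2) / t, t) * ((|t| ^ (((d : ℝ) - 5) / 2) : ℝ) : ℂ)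

set_option linter.unusedSectionVars false

section part1
theorem coS {X : Type} [NormedAddCommGroup X] [NormedSpace ℝ X] [FiniteDimensional ℝ X]
    (S : Set (X → ℂ))
    (hdec : ∀ f ∈ S, ∀ k : ℕ, ∃ C : ℝ, ∀ x, ‖x‖ ^ k * ‖f x‖ ≤ C)
    (hder : ∀ f ∈ S, ∃ D : X → X →L[ℝ] ℂ, (∀ x, HasFDerivAt f (D x) x) ∧
      ∀ a, (fun x => D x a) ∈ Submodule.span ℂ S)
    (f : X → ℂ) (hf : f ∈ S) : ∃ φ : SchwartzMap X ℂ, ∀ x, φ x = f x := by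
  have hdec' : ∀ f ∈ Submodule.span ℂ S, ∀ k : ℕ, ∃ C : ℝ, ∀ x, ‖x‖ ^ k * ‖f x‖ ≤ C := by
    intro f hf
    induction hf using Submodule.span_induction with
    | mem f h => exact hdec f h
    | zero => intro k; exact ⟨0, by simp⟩
    | add f g _ _ h1 h2 =>
      intro k
      obtain ⟨C1, h1⟩ := h1 k
      obtain ⟨C2, h2⟩ := h2 k
      refine ⟨C1 + C2, fun x => ?_⟩
      calc ‖x‖ ^ k * ‖(f + g) x‖ ≤ ‖x‖ ^ k * (‖f x‖ + ‖g x‖) := by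
            gcongr; exact norm_add_le _ _
        _ ≤ C1 + C2 := by rw [mul_add]; exact add_le_add (h1 x) (h2 x)
    | smul c f _ h =>
      intro k
      obtain ⟨C, h⟩ := h k
      refine ⟨‖c‖ * C, fun x => ?_⟩
      calc ‖x‖ ^ k * ‖(c • f) x‖ = ‖c‖ * (‖x‖ ^ k * ‖f x‖) := by
            simp; ring
        _ ≤ ‖c‖ * C := by gcongr; exact h x
  have hder' : ∀ f ∈ Submodule.span ℂ S, ∃ D : X → X →L[ℝ] ℂ, (∀ x, HasFDerivAt f (D x) x) ∧
      ∀ a, (fun x => D x a) ∈ Submodule.span ℂ S := by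
    intro f hf
    induction hf using Submodule.span_induction with
    | mem f h => exact hder f h
    | zero =>
      refine ⟨fun _ => 0, fun x => hasFDerivAt_const _ _, fun a => ?_⟩
      exact Submodule.zero_mem _
    | add f g _ _ h1 h2 =>
      obtain ⟨D1, h1, h1'⟩ := h1
      obtain ⟨D2, h2, h2'⟩ := h2
      exact ⟨fun x => D1 x + D2 x, fun x => (h1 x).add (h2 x),
        fun a => Submodule.add_mem _ (h1' a) (h2' a)⟩
    | smul c f _ h =>
      obtain ⟨D, h, h'⟩ := h
      exact ⟨fun x => c • D x, fun x => (h x).const_smul c,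
        fun a => Submodule.smul_mem _ c (h' a)⟩
  let b := Module.finBasis ℝ X
  have key : ∀ n : ℕ, ∀ f ∈ Submodule.span ℂ S, ContDiff ℝ n f ∧
      ∀ k : ℕ, ∃ C : ℝ, ∀ x, ‖x‖ ^ k * ‖iteratedFDeriv ℝ n f x‖ ≤ C := by
    intro n
    induction n with
    | zero =>
      intro f hf
      obtain ⟨D, hD, _⟩ := hder' f hf
      refine ⟨?_, fun k => ?_⟩
      · have : Differentiable ℝ f := fun x => (hD x).differentiableAt
        simpa using this.continuous
      · simpa using hdec' f hf k
    | succ n ih =>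
      intro f hf
      obtain ⟨D, hD, hD'⟩ := hder' f hf
      have hfd : fderiv ℝ f = D := funext fun x => (hD x).fderiv
      let co : Fin (Module.finrank ℝ X) → X →L[ℝ] ℝ := fun i =>
        LinearMap.toContinuousLinearMap (b.coord i)
      let Li : Fin (Module.finrank ℝ X) → ℂ →L[ℝ] (X →L[ℝ] ℂ) := fun i =>
        ContinuousLinearMap.smulRightL ℝ X ℂ (co i)
      have hsum : D = fun x => ∑ i, (Li i ∘ (fun x => D x (b i))) x := by
        funext x
        ext v
        have h1 : D x v = ∑ i, D x (b.repr v i • b i) := by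
          rw [← map_sum, b.sum_repr v]
        rw [h1]
        simp [Li, co]
      have hci : ∀ i, ContDiff ℝ n (Li i ∘ (fun x => D x (b i))) := fun i =>
        (Li i).contDiff.comp (ih _ (hD' (b i))).1
      refine ⟨?_, fun k => ?_⟩
      · push_cast
        rw [contDiff_succ_iff_fderiv]
        refine ⟨fun x => (hD x).differentiableAt, by simp, ?_⟩
        rw [hfd, hsum]
        exact ContDiff.sum fun i _ => hci i
      · choose C hC using fun i => (ih _ (hD' (b i))).2 k
        refine ⟨∑ i, ‖Li i‖ * C i, fun x => ?_⟩
        rw [← norm_iteratedFDeriv_fderiv, hfd, hsum, iteratedFDeriv_sum (fun i _ => hci i)]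
        rw [Finset.sum_apply]
        calc ‖x‖ ^ k * ‖∑ i, iteratedFDeriv ℝ n (Li i ∘ (fun x => D x (b i))) x‖
            ≤ ‖x‖ ^ k * ∑ i, ‖Li i‖ * ‖iteratedFDeriv ℝ n (fun x => D x (b i)) x‖ := by
              gcongr
              refine (norm_sum_le _ _).trans (Finset.sum_le_sum fun i _ => ?_)
              exact (Li i).norm_iteratedFDeriv_comp_left (ih _ (hD' (b i))).1.contDiffAt le_rfl
          _ = ∑ i, ‖Li i‖ * (‖x‖ ^ k * ‖iteratedFDeriv ℝ n (fun x => D x (b i)) x‖) := by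
              rw [Finset.mul_sum]; exact Finset.sum_congr rfl fun i _ => by ring
          _ ≤ ∑ i, ‖Li i‖ * C i := by
              gcongr with i
              exact hC i x
  have hf' := Submodule.subset_span hf (R := ℂ)
  refine ⟨⟨f, contDiff_infty.2 fun n => (key n f hf').1, fun k n => (key n f hf').2 k⟩,
    fun x => rfl⟩

/-- differentiation under the integral -/
theorem paramD {X A : Type} [NormedAddCommGroup X] [NormedSpace ℝ X] [FiniteDimensional ℝ X]
    [TopologicalSpace A] [MeasurableSpace A] [OpensMeasurableSpace A] [SecondCountableTopology A]
    (μ : Measure A) (k : X → A → ℂ) (D : X → A → X →L[ℝ] ℂ)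
    (hk : ∀ x, Continuous (k x)) (hD : ∀ x, Continuous (D x))
    (b b' : A → ℝ) (hb : Integrable b μ) (hb' : Integrable b' μ)
    (hkb : ∀ x a, ‖k x a‖ ≤ b a) (hDb : ∀ x a, ‖D x a‖ ≤ b' a)
    (hd : ∀ x a, HasFDerivAt (fun x => k x a) (D x a) x) :
    ∀ x, HasFDerivAt (fun x => ∫ a, k x a ∂μ) (∫ a, D x a ∂μ) x := by
  intro x
  refine hasFDerivAt_integral_of_dominated_of_fderiv_le (bound := b') (s := Set.univ)
    Filter.univ_mem ?_ ?_ ?_ ?_ ?_ ?_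
  · exact Eventually.of_forall fun x => (hk x).aestronglyMeasurable
  · exact hb.mono' (hk x).aestronglyMeasurable (Eventually.of_forall fun a => hkb x a)
  · exact (hD x).aestronglyMeasurable
  · exact Eventually.of_forall fun a x _ => hDb x a
  · exact hb'
  · exact Eventually.of_forall fun a x _ => hd x a

theorem paramD_apply {X A : Type} [NormedAddCommGroup X] [NormedSpace ℝ X]
    [FiniteDimensional ℝ X]
    [TopologicalSpace A] [MeasurableSpace A] [OpensMeasurableSpace A] [SecondCountableTopology A]
    (μ : Measure A) (D : A → X →L[ℝ] ℂ)
    (hD : Continuous D)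
    (b' : A → ℝ) (hb' : Integrable b' μ)
    (hDb : ∀ a, ‖D a‖ ≤ b' a) (v : X) :
    (∫ a, D a ∂μ) v = ∫ a, D a v ∂μ := by
  have : Integrable D μ := hb'.mono' hD.aestronglyMeasurable (Eventually.of_forall hDb)
  exact ContinuousLinearMap.integral_apply this v
end part1

section part2
theorem schw_bound {Y : Type} [NormedAddCommGroup Y] [NormedSpace ℝ Y] {F : Type}
    [NormedAddCommGroup F] [NormedSpace ℝ F]
    (φ : SchwartzMap Y F) (k : ℕ) : ∃ C : ℝ, 0 ≤ C ∧ ∀ y, (1 + ‖y‖) ^ k * ‖φ y‖ ≤ C := by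
  refine ⟨2 ^ k * ((Finset.Iic (k, 0)).sup (schwartzSeminormFamily ℝ Y F)) φ, by positivity,
    fun y => ?_⟩
  have := SchwartzMap.one_add_le_sup_seminorm_apply (𝕜 := ℝ) (m := (k, 0)) le_rfl le_rfl φ y
  rw [norm_iteratedFDeriv_zero] at this
  exact this

section avg
variable {X Y A : Type} [NormedAddCommGroup X] [NormedSpace ℝ X] [FiniteDimensional ℝ X]
  [NormedAddCommGroup Y] [NormedSpace ℝ Y] [FiniteDimensional ℝ Y]
  [TopologicalSpace A] [MeasurableSpace A] [OpensMeasurableSpace A] [SecondCountableTopology A]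

def avgSet (μ : Measure A) (L : A → X →L[ℝ] Y) : Set (X → ℂ) :=
  {f | ∃ c : A → ℂ, Continuous c ∧ (∃ M : ℝ, ∀ a, ‖c a‖ ≤ M) ∧ ∃ φ : SchwartzMap Y ℂ,
    f = fun x => ∫ a, c a * φ (L a x) ∂μ}

theorem avg_der (μ : Measure A) [IsFiniteMeasure μ] (L : A → X →L[ℝ] Y) (hL : Continuous L)
    (M : ℝ) (hM : ∀ a, ‖L a‖ ≤ M) (f : X → ℂ) (hf : f ∈ avgSet μ L) :
    ∃ D : X → X →L[ℝ] ℂ, (∀ x, HasFDerivAt f (D x) x) ∧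
      ∀ v, (fun x => D x v) ∈ Submodule.span ℂ (avgSet μ L) := by
  obtain ⟨c, hc, ⟨Mc, hMc⟩, φ, rfl⟩ := hf
  obtain ⟨C0, hC0, h0⟩ := schw_bound φ 0
  obtain ⟨C1, hC1, h1⟩ := schw_bound (SchwartzMap.fderivCLM ℝ Y ℂ φ) 0
  simp only [pow_zero, one_mul, SchwartzMap.fderivCLM_apply] at h0 h1
  have hfc : Continuous (fderiv ℝ φ) := (SchwartzMap.fderivCLM ℝ Y ℂ φ).continuous
  have hDc : ∀ x, Continuous fun a => c a • (fderiv ℝ φ (L a x)).comp (L a) := fun x => by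
    have : Continuous fun a => L a x := hL.clm_apply continuous_const
    exact hc.smul ((hfc.comp this).clm_comp hL)
  have hDb : ∀ x a, ‖c a • (fderiv ℝ φ (L a x)).comp (L a)‖ ≤ Mc * (C1 * M) := fun x a => by
    rw [norm_smul]
    have := hMc a
    have := hM a
    have := norm_nonneg (c a)
    gcongr
    · linarith
    · refine (ContinuousLinearMap.opNorm_comp_le _ _).trans ?_
      gcongr
      exact h1 _
  refine ⟨fun x => ∫ a, c a • (fderiv ℝ φ (L a x)).comp (L a) ∂μ, ?_, ?_⟩
  · refine paramD μ (fun x a => c a * φ (L a x)) _ ?_ hDc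
      (fun _ => Mc * C0) (fun _ => Mc * (C1 * M)) (integrable_const _) (integrable_const _) ?_
      hDb ?_
    · intro x
      have : Continuous fun a => L a x := hL.clm_apply continuous_const
      exact hc.mul (φ.continuous.comp this)
    · intro x a
      rw [norm_mul]
      have := hMc a
      have := norm_nonneg (c a)
      gcongr
      · linarith
      · exact h0 _
    · intro x a
      have := ((φ.hasFDerivAt (L a x)).comp x (L a).hasFDerivAt).const_smul (c a)
      exact this
  · intro v
    let b := Module.finBasis ℝ Y
    let co : Fin (Module.finrank ℝ Y) → Y →L[ℝ] ℝ := fun i =>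
        LinearMap.toContinuousLinearMap (b.coord i)
    have hLv : Continuous fun a => L a v := hL.clm_apply continuous_const
    have hcj : ∀ i, Continuous fun a => c a * (co i (L a v) : ℂ) := fun i =>
      hc.mul (Complex.continuous_ofReal.comp ((co i).continuous.comp hLv))
    have hcjb : ∀ i a, ‖c a * (co i (L a v) : ℂ)‖ ≤ Mc * (‖co i‖ * (M * ‖v‖)) := fun i a => by
      rw [norm_mul]
      have := hMc a
      have := norm_nonneg (c a)
      gcongr
      · linarith
      · rw [Complex.norm_real]
        refine ((co i).le_opNorm _).trans ?_
        gcongr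
        exact (L a).le_of_opNorm_le (hM a) v
    let ψ : Fin (Module.finrank ℝ Y) → SchwartzMap Y ℂ := fun i =>
      SchwartzMap.evalCLM ℝ Y ℂ (b i) (SchwartzMap.fderivCLM ℝ Y ℂ φ)
    have hψ : ∀ i y, ψ i y = fderiv ℝ φ y (b i) := fun i y => rfl
    have : (fun x => (∫ a, c a • (fderiv ℝ φ (L a x)).comp (L a) ∂μ) v) =
        ∑ i, fun x => ∫ a, (c a * (co i (L a v) : ℂ)) * ψ i (L a x) ∂μ := by
      funext x
      rw [paramD_apply μ _ (hDc x) _ (integrable_const (Mc * (C1 * M))) (hDb x) v]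
      rw [Finset.sum_apply, ← integral_finsetSum]
      · congr 1
        funext a
        have h1 : fderiv ℝ φ (L a x) (L a v) =
            ∑ i, fderiv ℝ φ (L a x) (b.repr (L a v) i • b i) := by
          rw [← map_sum, b.sum_repr]
        simp [h1, hψ, Finset.mul_sum, co, mul_assoc]
      · intro i _
        obtain ⟨C2, hC2, h2⟩ := schw_bound (ψ i) 0
        refine Integrable.mono' (integrable_const (Mc * (‖co i‖ * (M * ‖v‖)) * C2)) ?_
          (Eventually.of_forall fun a => ?_)
        · have : Continuous fun a => L a x := hL.clm_apply continuous_const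
          exact ((hcj i).mul ((ψ i).continuous.comp this)).aestronglyMeasurable
        · rw [norm_mul]
          gcongr
          · exact (norm_nonneg _).trans (hcjb i a)
          · exact hcjb i a
          · simpa using h2 (L a x)
    rw [this]
    refine Submodule.sum_mem _ fun i _ => Submodule.subset_span ?_
    exact ⟨_, hcj i, ⟨_, hcjb i⟩, ψ i, rfl⟩

theorem avg_der_span (μ : Measure A) [IsFiniteMeasure μ] (L : A → X →L[ℝ] Y) (hL : Continuous L)
    (M : ℝ) (hM : ∀ a, ‖L a‖ ≤ M) (f : X → ℂ) (hf : f ∈ Submodule.span ℂ (avgSet μ L)) :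
    ∃ D : X → X →L[ℝ] ℂ, (∀ x, HasFDerivAt f (D x) x) ∧
      ∀ v, (fun x => D x v) ∈ Submodule.span ℂ (avgSet μ L) := by
  induction hf using Submodule.span_induction with
  | mem f h => exact avg_der μ L hL M hM f h
  | zero =>
    refine ⟨fun _ => 0, fun x => hasFDerivAt_const _ _, fun a => ?_⟩
    exact Submodule.zero_mem _
  | add f g _ _ h1 h2 =>
    obtain ⟨D1, h1, h1'⟩ := h1
    obtain ⟨D2, h2, h2'⟩ := h2
    exact ⟨fun x => D1 x + D2 x, fun x => (h1 x).add (h2 x),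
      fun a => Submodule.add_mem _ (h1' a) (h2' a)⟩
  | smul c f _ h =>
    obtain ⟨D, h, h'⟩ := h
    exact ⟨fun x => c • D x, fun x => (h x).const_smul c,
      fun a => Submodule.smul_mem _ c (h' a)⟩

theorem avg_decay (μ : Measure A) [IsFiniteMeasure μ] (L : A → X →L[ℝ] Y)
    (Z : Set X) (hZ : ∀ x ∈ Z, ∀ a, ‖x‖ ≤ 1 + ‖L a x‖)
    (f : X → ℂ) (hf : f ∈ Submodule.span ℂ (avgSet μ L)) (k : ℕ) :
    ∃ C : ℝ, ∀ x ∈ Z, ‖x‖ ^ k * ‖f x‖ ≤ C := by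
  induction hf using Submodule.span_induction with
  | mem f h =>
    obtain ⟨c, hc, ⟨Mc, hMc⟩, φ, rfl⟩ := h
    obtain ⟨C0, hC0, h0⟩ := schw_bound φ k
    refine ⟨Mc * C0 * μ.real Set.univ, fun x hx => ?_⟩
    have h2 : ‖x‖ ^ k * ‖∫ a, c a * φ (L a x) ∂μ‖ =
        ‖∫ a, ((‖x‖ ^ k : ℝ) : ℂ) * (c a * φ (L a x)) ∂μ‖ := by
      rw [integral_const_mul, norm_mul, Complex.norm_real]
      simp
    rw [h2]
    refine norm_integral_le_of_norm_le_const (Eventually.of_forall fun a => ?_)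
    rw [norm_mul, norm_mul, Complex.norm_real, norm_pow, norm_norm]
    calc ‖x‖ ^ k * (‖c a‖ * ‖φ (L a x)‖) = ‖c a‖ * (‖x‖ ^ k * ‖φ (L a x)‖) := by ring
      _ ≤ ‖c a‖ * ((1 + ‖L a x‖) ^ k * ‖φ (L a x)‖) := by
        gcongr; exact hZ x hx a
      _ ≤ Mc * C0 := by
        have := hMc a
        have := norm_nonneg (c a)
        gcongr
        · linarith
        · exact h0 _
  | zero => exact ⟨0, by simp⟩
  | add f g _ _ h1 h2 =>
    obtain ⟨C1, h1⟩ := h1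
    obtain ⟨C2, h2⟩ := h2
    refine ⟨C1 + C2, fun x hx => ?_⟩
    calc ‖x‖ ^ k * ‖(f + g) x‖ ≤ ‖x‖ ^ k * (‖f x‖ + ‖g x‖) := by
          gcongr; exact norm_add_le _ _
      _ ≤ C1 + C2 := by rw [mul_add]; exact add_le_add (h1 x hx) (h2 x hx)
  | smul c f _ h =>
    obtain ⟨C, h⟩ := h
    refine ⟨‖c‖ * C, fun x hx => ?_⟩
    calc ‖x‖ ^ k * ‖(c • f) x‖ = ‖c‖ * (‖x‖ ^ k * ‖f x‖) := by
          simp; ring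
      _ ≤ ‖c‖ * C := by gcongr; exact h x hx

end avg

/-- sphere average of a Schwartz function -/
theorem sphere_avg {E : Type} [NormedAddCommGroup E] [InnerProductSpace ℝ E]
    [FiniteDimensional ℝ E] [MeasurableSpace E] [BorelSpace E]
    (σ : Measure (Metric.sphere (0 : E) 1)) [IsFiniteMeasure σ]
    (φ : SchwartzMap ((ℝ × E) × E) ℂ) :
    ∃ ψ : SchwartzMap ((ℝ × ℝ) × ℝ) ℂ, ∀ x, ψ x =
      ∫ ω, φ ((x.1.1, x.1.2 • (ω : E)), x.2 • (ω : E)) ∂σ := by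
  let L : Metric.sphere (0 : E) 1 → ((ℝ × ℝ) × ℝ) →L[ℝ] ((ℝ × E) × E) := fun ω =>
    (((ContinuousLinearMap.id ℝ ℝ).prodMap
      (ContinuousLinearMap.toSpanSingleton ℝ (ω : E))).prodMap
      (ContinuousLinearMap.toSpanSingleton ℝ (ω : E)))
  have hLa : ∀ ω x, L ω x = ((x.1.1, x.1.2 • (ω : E)), x.2 • (ω : E)) := fun ω x => rfl
  have hLn : ∀ ω x, ‖L ω x‖ = ‖x‖ := fun ω x => by
    simp [hLa, Prod.norm_def, norm_smul]
  have hLc : Continuous L := by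
    rw [continuous_clm_apply]
    intro x
    simp only [hLa]
    fun_prop
  have h := coS (avgSet σ L)
    (fun f hf k => by
      obtain ⟨C, hC⟩ := avg_decay σ L Set.univ (fun x _ a => by rw [hLn]; linarith) f
        (Submodule.subset_span hf) k
      exact ⟨C, fun x => hC x trivial⟩)
    (fun f hf => avg_der σ L hLc 1
      (fun a => ContinuousLinearMap.opNorm_le_bound _ zero_le_one fun x => by simp [hLn]) f hf)
    (fun x => ∫ ω, 1 * φ (L ω x) ∂σ)
    ⟨fun _ => 1, continuous_const, ⟨1, by simp⟩, φ, rfl⟩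
  simpa [hLa] using h

theorem hadamard {Q : Type} [NormedAddCommGroup Q] [NormedSpace ℝ Q]
    [FiniteDimensional ℝ Q] (φ : SchwartzMap (ℝ × Q) ℂ) (h0 : ∀ q, φ (0, q) = 0) :
    ∃ ψ : SchwartzMap (ℝ × Q) ℂ, ∀ s q, φ (s, q) = s * ψ (s, q) := by
  let L : Set.Icc (0:ℝ) 1 → (ℝ × Q) →L[ℝ] (ℝ × Q) := fun θ =>
    ((θ : ℝ) • ContinuousLinearMap.id ℝ ℝ).prodMap (ContinuousLinearMap.id ℝ Q)
  have hLa : ∀ θ x, L θ x = (θ * x.1, x.2) := fun θ x => rfl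
  have hLn : ∀ θ, ‖L θ‖ ≤ 1 := fun θ =>
    ContinuousLinearMap.opNorm_le_bound _ zero_le_one fun x => by
      rw [hLa, Prod.norm_def, Prod.norm_def, one_mul, norm_mul]
      gcongr
      have := θ.2.1
      have h2 := θ.2.2
      rw [Real.norm_of_nonneg this]
      exact mul_le_of_le_one_left (norm_nonneg _) h2
  have hLc : Continuous L := by
    rw [continuous_clm_apply]
    intro x
    simp only [hLa]
    fun_prop
  let μ : Measure (Set.Icc (0:ℝ) 1) := volume
  let V := Submodule.span ℂ (avgSet μ L)
  let S : Set (ℝ × Q → ℂ) := {G | G ∈ V ∧ ∃ j : ℕ, ∃ χ : SchwartzMap (ℝ × Q) ℂ,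
    ∀ x, χ x = (x.1 : ℂ) ^ j * G x}
  have hfst : (fun x : ℝ × Q => ((x.1 : ℝ) : ℂ)).HasTemperateGrowth :=
    (Complex.ofRealCLM.comp (ContinuousLinearMap.fst ℝ ℝ Q)).hasTemperateGrowth
  let ψ' : SchwartzMap (ℝ × Q) ℂ :=
    SchwartzMap.evalCLM ℝ (ℝ × Q) ℂ (1, 0) (SchwartzMap.fderivCLM ℝ (ℝ × Q) ℂ φ)
  have hψ' : ∀ x, ψ' x = fderiv ℝ φ x (1, 0) := fun x => rfl
  let G : ℝ × Q → ℂ := fun x => ∫ θ, 1 * ψ' (L θ x) ∂μ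
  have hG : ∀ s q, φ (s, q) = s * G (s, q) := by
    intro s q
    have hd : ∀ θ ∈ Set.uIcc (0:ℝ) 1, HasDerivAt (fun θ : ℝ => φ (θ * s, q))
        (s * ψ' (θ * s, q)) θ := by
      intro θ _
      have h1 : HasDerivAt (fun θ : ℝ => (θ * s, q)) (s, (0 : Q)) θ := by
        have := ((hasDerivAt_id θ).mul_const s).prodMk (hasDerivAt_const θ q)
        simpa using this
      have h2 := (φ.hasFDerivAt (θ * s, q)).comp_hasDerivAt θ h1
      have h3 : fderiv ℝ φ (θ * s, q) (s, 0) = s * ψ' (θ * s, q) := by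
        rw [hψ']
        have : ((s, 0) : ℝ × Q) = s • ((1, 0) : ℝ × Q) := by simp
        rw [this, map_smul]
        simp
      rw [← h3]
      exact h2
    have hcont : Continuous fun θ : ℝ => s * ψ' (θ * s, q) := by
      have := ψ'.continuous
      fun_prop
    have := intervalIntegral.integral_eq_sub_of_hasDerivAt hd (hcont.intervalIntegrable _ _)
    simp only [one_mul, zero_mul, h0, sub_zero] at this
    rw [← this, intervalIntegral.integral_const_mul]
    congr 1
    rw [intervalIntegral.integral_of_le zero_le_one, ← integral_Icc_eq_integral_Ioc,
      ← integral_subtype_comap measurableSet_Icc]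
    simp only [G, one_mul, hLa]
    rfl
  have hGS : G ∈ S := by
    refine ⟨Submodule.subset_span ⟨fun _ => 1, continuous_const, ⟨1, by simp⟩, ψ', rfl⟩, 1, φ, ?_⟩
    rintro ⟨s, q⟩
    simpa using hG s q
  obtain ⟨ψ, hψ⟩ := coS S (by
    rintro f ⟨hf, j, χ, hχ⟩ k
    obtain ⟨C1, h1⟩ := avg_decay μ L {x | ‖x.1‖ ≤ 1} (fun x hx a => by
      have hx : ‖x.1‖ ≤ 1 := hx
      rw [hLa, Prod.norm_def, Prod.norm_def]
      refine max_le ?_ ?_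
      · have : 0 ≤ max ‖(a : ℝ) * x.1‖ ‖x.2‖ := le_max_of_le_right (norm_nonneg _)
        simp only
        linarith
      · have : ‖x.2‖ ≤ max ‖(a : ℝ) * x.1‖ ‖x.2‖ := le_max_right _ _
        simp only
        linarith) f hf k
    obtain ⟨C2, h2⟩ := χ.decay k 0
    refine ⟨max C1 C2, fun x => ?_⟩
    rcases le_total ‖x.1‖ 1 with hx | hx
    · exact (h1 x hx).trans (le_max_left _ _)
    · refine le_trans ?_ ((h2.2 x).trans (le_max_right _ _))
      rw [norm_iteratedFDeriv_zero, hχ, norm_mul, norm_pow, Complex.norm_real]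
      gcongr
      exact le_mul_of_one_le_left (norm_nonneg _) (one_le_pow₀ hx)) (by
    rintro f ⟨hf, j, χ, hχ⟩
    obtain ⟨D, hD, hD'⟩ := avg_der_span μ L hLc 1 hLn f hf
    refine ⟨D, hD, fun v => Submodule.subset_span ⟨hD' v, j + 1, ?_⟩⟩
    refine ⟨SchwartzMap.smulLeftCLM ℂ (fun x : ℝ × Q => ((x.1 : ℝ) : ℂ))
      (SchwartzMap.evalCLM ℝ (ℝ × Q) ℂ v (SchwartzMap.fderivCLM ℝ (ℝ × Q) ℂ χ)) -
      ((j : ℂ) * (v.1 : ℂ)) • χ, fun x => ?_⟩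
    have hχ' : ⇑χ = fun x => (x.1 : ℂ) ^ j * f x := funext hχ
    have hp : HasFDerivAt (fun x : ℝ × Q => ((x.1 : ℝ) : ℂ))
        (Complex.ofRealCLM.comp (ContinuousLinearMap.fst ℝ ℝ Q)) x :=
      (Complex.ofRealCLM.comp (ContinuousLinearMap.fst ℝ ℝ Q)).hasFDerivAt
    have hpd := (hp.pow j).mul (hD x)
    replace hpd := hpd.congr_of_eventuallyEq (f₁ := ⇑χ) (Eventually.of_forall hχ)
    have e1 : (SchwartzMap.evalCLM ℝ (ℝ × Q) ℂ v (SchwartzMap.fderivCLM ℝ (ℝ × Q) ℂ χ)) x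
      = fderiv ℝ χ x v := rfl
    rw [SchwartzMap.sub_apply, SchwartzMap.smulLeftCLM_apply_apply hfst, e1, hpd.fderiv,
      SchwartzMap.smul_apply, hχ]
    simp
    rcases j with _ | j
    · simp
    · simp only [Nat.add_sub_cancel]
      push_cast
      ring) G hGS
  exact ⟨ψ, fun s q => by rw [hψ]; exact hG s q⟩
end part2

section part3
theorem tg_fderiv {X : Type} [NormedAddCommGroup X] [NormedSpace ℝ X] {c : X → ℂ}
    (hc : c.HasTemperateGrowth) (v : X) : (fun x => fderiv ℝ c x v).HasTemperateGrowth := by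
  have h1 : (fderiv ℝ c).HasTemperateGrowth := by
    refine ⟨hc.1.fderiv_right (m := ((⊤ : ℕ∞) : WithTop ℕ∞)) (by simp), fun n => ?_⟩
    obtain ⟨k, C, h⟩ := hc.2 (n + 1)
    exact ⟨k, C, fun x => by rw [norm_iteratedFDeriv_fderiv]; exact h x⟩
  exact (ContinuousLinearMap.apply ℝ ℂ v).hasTemperateGrowth.comp h1

/-- precomposition with a continuous linear equivalence -/
def sc {X Y : Type} [NormedAddCommGroup X] [NormedSpace ℝ X] [NormedAddCommGroup Y]
    [NormedSpace ℝ Y] (e : X ≃L[ℝ] Y) (φ : SchwartzMap Y ℂ) : SchwartzMap X ℂ :=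
  SchwartzMap.compCLMOfContinuousLinearEquiv ℝ e φ

theorem sc_apply {X Y : Type} [NormedAddCommGroup X] [NormedSpace ℝ X] [NormedAddCommGroup Y]
    [NormedSpace ℝ Y] (e : X ≃L[ℝ] Y) (φ : SchwartzMap Y ℂ) (x : X) : sc e φ x = φ (e x) := rfl

section radial
variable {E Q : Type} [NormedAddCommGroup E] [InnerProductSpace ℝ E] [FiniteDimensional ℝ E]
  [NormedAddCommGroup Q] [NormedSpace ℝ Q] [FiniteDimensional ℝ Q]

def negfst (Q : Type) [NormedAddCommGroup Q] [NormedSpace ℝ Q] : (ℝ × Q) ≃L[ℝ] (ℝ × Q) :=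
  (ContinuousLinearEquiv.neg ℝ).prodCongr (ContinuousLinearEquiv.refl ℝ Q)

theorem negfst_apply (s : ℝ) (q : Q) : negfst Q (s, q) = (-s, q) := rfl

theorem even_deriv (f : SchwartzMap (ℝ × Q) ℂ) (hf : ∀ s q, f (-s, q) = f (s, q)) (s : ℝ) (q : Q)
    (a : ℝ) (b : Q) : fderiv ℝ f (-s, q) (a, b) = fderiv ℝ f (s, q) (-a, b) := by
  have h1 : (f ∘ negfst Q) = f := funext fun ⟨s, q⟩ => hf s q
  have h2 := (f.hasFDerivAt (negfst Q (-s, q))).comp (-s, q) (negfst Q).hasFDerivAt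
  rw [h1] at h2
  rw [h2.fderiv]
  simp [negfst_apply]

theorem radial_der (f : SchwartzMap (ℝ × Q) ℂ) (hf : ∀ s q, f (-s, q) = f (s, q))
    (g : SchwartzMap (ℝ × Q) ℂ) (hg : ∀ s q, fderiv ℝ f (s, q) (1, 0) = s * g (s, q))
    (x : E × Q) :
    HasFDerivAt (fun x : E × Q => f (‖x.1‖, x.2))
      ((fderiv ℝ f (‖x.1‖, x.2)).comp ((0 : E × Q →L[ℝ] ℝ).prod (ContinuousLinearMap.snd ℝ E Q)) +
        g (‖x.1‖, x.2) • (Complex.ofRealCLM.comp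
          ((innerSL ℝ x.1).comp (ContinuousLinearMap.fst ℝ E Q)))) x := by
  have hsplit : ∀ s q (a : ℝ) (b : Q), fderiv ℝ f (s, q) (a, b) =
      fderiv ℝ f (s, q) (0, b) + a * (s * g (s, q)) := by
    intro s q a b
    have : ((a, b) : ℝ × Q) = (0, b) + a • (1, 0) := by simp
    rw [this, map_add, map_smul, hg]
    simp
  obtain ⟨η, q⟩ := x
  by_cases hη : η = 0
  · subst hη
    have h1 := (f.hasFDerivAt (0, q)).isLittleO
    refine HasFDerivAt.of_isLittleO ?_
    have ht : Tendsto (fun x : E × Q => ((‖x.1‖, x.2) : ℝ × Q)) (nhds (0, q)) (nhds (0, q)) := by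
      have : Continuous (fun x : E × Q => ((‖x.1‖, x.2) : ℝ × Q)) := by fun_prop
      simpa using this.tendsto (0, q)
    have h2 := h1.comp_tendsto ht
    refine Asymptotics.IsLittleO.trans_isBigO (g := fun x' : E × Q => x' - (0, q)) ?_
      (Asymptotics.isBigO_refl _ _)
    refine (h2.congr_left ?_).trans_isBigO ?_
    · rintro ⟨η', q'⟩
      simp [hsplit 0 q ‖η'‖]
      rw [← map_sub]
      simp
    · refine Asymptotics.IsBigO.of_bound 1 (Eventually.of_forall fun x' => ?_)
      simp [Prod.norm_def]
  · have hn : HasFDerivAt (fun η : E => ‖η‖) ((1 / ‖η‖) • innerSL ℝ η) η := by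
      have h1 := (hasStrictFDerivAt_norm_sq η).hasFDerivAt.sqrt (by simpa using hη)
      simp only [Real.sqrt_sq (norm_nonneg _)] at h1
      refine h1.congr_fderiv ?_
      ext v
      simp
      field_simp
    have h2 : HasFDerivAt (fun x : E × Q => ((‖x.1‖, x.2) : ℝ × Q))
        ((((1 / ‖η‖) • innerSL ℝ η).comp (ContinuousLinearMap.fst ℝ E Q)).prod
          (ContinuousLinearMap.snd ℝ E Q)) (η, q) :=
      (HasFDerivAt.comp (η, q) hn (ContinuousLinearMap.fst ℝ E Q).hasFDerivAt).prodMk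
        (ContinuousLinearMap.snd ℝ E Q).hasFDerivAt
    have h3 := (f.hasFDerivAt (‖η‖, q)).comp (η, q) h2
    refine h3.congr_fderiv ?_
    have hη' : (‖η‖ : ℂ) ≠ 0 := by simpa using hη
    ext v
    · simp
      rw [hsplit]
      simp
      field_simp
    · simp

theorem radial (f : SchwartzMap (ℝ × Q) ℂ) (hf : ∀ s q, f (-s, q) = f (s, q)) :
    ∃ ψ : SchwartzMap (E × Q) ℂ, ∀ η q, ψ (η, q) = f (‖η‖, q) := by
  let S : Set (E × Q → ℂ) := {F | ∃ c : E × Q → ℂ, c.HasTemperateGrowth ∧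
    ∃ f : SchwartzMap (ℝ × Q) ℂ, (∀ s q, f (-s, q) = f (s, q)) ∧
      F = fun x => c x * f (‖x.1‖, x.2)}
  obtain ⟨ψ, hψ⟩ := coS S (by
    rintro F ⟨c, hc, f, hf, rfl⟩ k
    obtain ⟨l, C, hC⟩ := hc.2 0
    obtain ⟨C1, hC1, h1⟩ := schw_bound f (l + k)
    refine ⟨|C| * C1, fun x => ?_⟩
    have hx : ‖((‖x.1‖, x.2) : ℝ × Q)‖ = ‖x‖ := by simp [Prod.norm_def]
    have h2 := hC x
    have h3 := h1 (‖x.1‖, x.2)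
    rw [norm_iteratedFDeriv_zero] at h2
    rw [hx] at h3
    rw [norm_mul]
    calc ‖x‖ ^ k * (‖c x‖ * ‖f (‖x.1‖, x.2)‖)
        ≤ (1 + ‖x‖) ^ k * ((|C| * (1 + ‖x‖) ^ l) * ‖f (‖x.1‖, x.2)‖) := by
          gcongr
          · linarith
          · refine h2.trans ?_
            gcongr
            exact le_abs_self C
      _ = |C| * ((1 + ‖x‖) ^ (l + k) * ‖f (‖x.1‖, x.2)‖) := by ring
      _ ≤ |C| * C1 := by gcongr) (by
    rintro F ⟨c, hc, f, hf, rfl⟩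
    have hodd : ∀ q, fderiv ℝ f (0, q) (1, 0) = 0 := by
      intro q
      have h1 := even_deriv f hf 0 q 1 0
      rw [neg_zero] at h1
      have : ((-1, 0) : ℝ × Q) = -(1, 0) := by simp
      rw [this, map_neg] at h1
      exact self_eq_neg.1 h1
    obtain ⟨g0, hg0⟩ := hadamard
      (SchwartzMap.evalCLM ℝ (ℝ × Q) ℂ (1, 0) (SchwartzMap.fderivCLM ℝ (ℝ × Q) ℂ f)) hodd
    replace hg0 : ∀ s q, fderiv ℝ f (s, q) (1, 0) = s * g0 (s, q) := hg0
    let g : SchwartzMap (ℝ × Q) ℂ := (1 / 2 : ℂ) • (g0 + sc (negfst Q) g0)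
    have hga : ∀ s q, g (s, q) = (1 / 2) * (g0 (s, q) + g0 (-s, q)) := fun s q => rfl
    have hge : ∀ s q, g (-s, q) = g (s, q) := fun s q => by rw [hga, hga, neg_neg, add_comm]
    have hg : ∀ s q, fderiv ℝ f (s, q) (1, 0) = s * g (s, q) := by
      intro s q
      have h1 := even_deriv f hf s q 1 0
      have : ((-1, 0) : ℝ × Q) = -(1, 0) := by simp
      rw [this, map_neg, hg0, hg0] at h1
      rw [hga, hg0]
      push_cast at h1
      linear_combination (1/2) * h1
    refine ⟨_, fun x => ((hc.1.differentiable (by simp) x).hasFDerivAt).mul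
      (radial_der f hf g hg x), fun v => ?_⟩
    let f2 : SchwartzMap (ℝ × Q) ℂ :=
      SchwartzMap.evalCLM ℝ (ℝ × Q) ℂ (0, v.2) (SchwartzMap.fderivCLM ℝ (ℝ × Q) ℂ f)
    have hf2a : ∀ x, f2 x = fderiv ℝ f x (0, v.2) := fun x => rfl
    have hf2 : ∀ s q, f2 (-s, q) = f2 (s, q) := fun s q => by
      rw [hf2a, hf2a, even_deriv f hf, neg_zero]
    have hin : (fun x : E × Q => ((inner ℝ x.1 v.1 : ℝ) : ℂ)).HasTemperateGrowth := by
      have h9 := (Complex.ofRealCLM.comp ((innerSL ℝ v.1).comp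
        (ContinuousLinearMap.fst ℝ E Q))).hasTemperateGrowth
      convert h9 using 1
      funext x
      simp [real_inner_comm]
    have e1 : (fun x : E × Q => fderiv ℝ c x v * f (‖x.1‖, x.2)) ∈ Submodule.span ℂ S :=
      Submodule.subset_span ⟨_, tg_fderiv hc v, f, hf, rfl⟩
    have e2 : (fun x : E × Q => c x * f2 (‖x.1‖, x.2)) ∈ Submodule.span ℂ S :=
      Submodule.subset_span ⟨_, hc, f2, hf2, rfl⟩
    have e3 : (fun x : E × Q => (c x * ((inner ℝ x.1 v.1 : ℝ) : ℂ)) * g (‖x.1‖, x.2))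
        ∈ Submodule.span ℂ S :=
      Submodule.subset_span ⟨_, hc.mul hin, g, hge, rfl⟩
    convert Submodule.add_mem _ e1 (Submodule.add_mem _ e2 e3) using 1
    funext x
    simp [hf2a]
    ring)
    (fun x => 1 * f (‖x.1‖, x.2)) ⟨fun _ => 1, Function.HasTemperateGrowth.const 1, f, hf, rfl⟩
  exact ⟨ψ, fun η q => by simpa using hψ (η, q)⟩

end radial
end part3

section part4
section lift
variable {E : Type} [NormedAddCommGroup E] [InnerProductSpace ℝ E] [FiniteDimensional ℝ E]

def swp (A B C : Type) [NormedAddCommGroup A] [NormedSpace ℝ A] [NormedAddCommGroup B]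
    [NormedSpace ℝ B] [NormedAddCommGroup C] [NormedSpace ℝ C] : (A × (B × C)) ≃L[ℝ] (B × (A × C)) :=
  { toFun := fun x => (x.2.1, (x.1, x.2.2))
    invFun := fun x => (x.2.1, (x.1, x.2.2))
    left_inv := fun x => rfl
    right_inv := fun x => rfl
    map_add' := fun x y => rfl
    map_smul' := fun x y => rfl
    continuous_toFun := by fun_prop
    continuous_invFun := by fun_prop }

def prm (A B C : Type) [NormedAddCommGroup A] [NormedSpace ℝ A] [NormedAddCommGroup B]
    [NormedSpace ℝ B] [NormedAddCommGroup C] [NormedSpace ℝ C] : ((C × B) × A) ≃L[ℝ] (A × (B × C)) :=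
  { toFun := fun x => (x.2, (x.1.2, x.1.1))
    invFun := fun x => ((x.2.2, x.2.1), x.1)
    left_inv := fun x => rfl
    right_inv := fun x => rfl
    map_add' := fun x y => rfl
    map_smul' := fun x y => rfl
    continuous_toFun := by fun_prop
    continuous_invFun := by fun_prop }

theorem lift_ee (H : SchwartzMap (ℝ × (ℝ × ℝ)) ℂ) (h1 : ∀ t s u, H (-t, (s, u)) = H (t, (s, u)))
    (h2 : ∀ t s u, H (t, (-s, u)) = H (t, (s, u))) :
    ∃ ψ : SchwartzMap ((ℝ × E) × E) ℂ, ∀ u z η, ψ ((u, z), η) = H (‖z‖, (‖η‖, u)) := by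
  obtain ⟨ψ1, hψ1⟩ := radial (E := E) H (fun s q => h1 s q.1 q.2)
  obtain ⟨ψ2, hψ2⟩ := radial (E := E) (sc (swp ℝ E ℝ) ψ1) (fun s q => by
    show ψ1 (q.1, (-s, q.2)) = ψ1 (q.1, (s, q.2))
    rw [hψ1, hψ1, h2])
  refine ⟨sc (prm E E ℝ) ψ2, fun u z η => ?_⟩
  show ψ2 (η, (z, u)) = _
  rw [hψ2]
  show ψ1 (z, (‖η‖, u)) = _
  rw [hψ1]

theorem mulTG {X : Type} [NormedAddCommGroup X] [NormedSpace ℝ X] (c : X → ℂ)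
    (hc : c.HasTemperateGrowth) (φ : SchwartzMap X ℂ) :
    ∃ ψ : SchwartzMap X ℂ, ∀ x, ψ x = c x * φ x :=
  ⟨SchwartzMap.smulLeftCLM ℂ c φ, fun x => by
    rw [SchwartzMap.smulLeftCLM_apply_apply hc]; rfl⟩

theorem abs_even {f : ℝ → ℂ} (hf : ∀ t, f (-t) = f t) (t : ℝ) : f |t| = f t := by
  rcases abs_choice t with h | h <;> rw [h]
  exact hf t

theorem lift (F₂ : SchwartzMap ((ℝ × ℝ) × ℝ) ℂ)
    (hF : ∀ u t s, F₂ ((u, -t), -s) = F₂ ((u, t), s)) :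
    ∃ F : SchwartzMap ((ℝ × E) × E) ℂ, ∀ u t s, ∀ ω : E, ‖ω‖ = 1 →
      F ((u, t • ω), s • ω) = F₂ ((u, t), s) := by
  let f : SchwartzMap (ℝ × (ℝ × ℝ)) ℂ := sc ((swp ℝ ℝ ℝ).trans (prm ℝ ℝ ℝ).symm) F₂
  have hf : ∀ t s u, f (t, (s, u)) = F₂ ((u, t), s) := fun t s u => rfl
  have hfs : ∀ t s u, f (-t, (-s, u)) = f (t, (s, u)) := fun t s u => by rw [hf, hf, hF]
  let N1 : (ℝ × (ℝ × ℝ)) ≃L[ℝ] (ℝ × (ℝ × ℝ)) := negfst (ℝ × ℝ)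
  let N2 : (ℝ × (ℝ × ℝ)) ≃L[ℝ] (ℝ × (ℝ × ℝ)) :=
    (ContinuousLinearEquiv.refl ℝ ℝ).prodCongr (negfst ℝ)
  have aN1 : ∀ (g : SchwartzMap (ℝ × (ℝ × ℝ)) ℂ) t s u, sc N1 g (t, (s, u)) = g (-t, (s, u)) :=
    fun g t s u => rfl
  have aN2 : ∀ (g : SchwartzMap (ℝ × (ℝ × ℝ)) ℂ) t s u, sc N2 g (t, (s, u)) = g (t, (-s, u)) :=
    fun g t s u => rfl
  let fe : SchwartzMap (ℝ × (ℝ × ℝ)) ℂ := (1 / 2 : ℂ) • (f + sc N1 f)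
  let fo : SchwartzMap (ℝ × (ℝ × ℝ)) ℂ := (1 / 2 : ℂ) • (f - sc N1 f)
  have hfe : ∀ t s u, fe (t, (s, u)) = (1 / 2) * (f (t, (s, u)) + f (-t, (s, u))) :=
    fun t s u => rfl
  have hfo : ∀ t s u, fo (t, (s, u)) = (1 / 2) * (f (t, (s, u)) - f (-t, (s, u))) :=
    fun t s u => rfl
  have hfs' : ∀ t s u, f (t, (-s, u)) = f (-t, (s, u)) := fun t s u => by
    rw [← hfs, neg_neg]
  obtain ⟨g, hg⟩ := hadamard fo (fun q => by
    obtain ⟨s, u⟩ := q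
    rw [hfo]; simp)
  let g' : SchwartzMap (ℝ × (ℝ × ℝ)) ℂ := (1 / 2 : ℂ) • (g - sc N2 g)
  have hg' : ∀ t s u, g' (t, (s, u)) = (1 / 2) * (g (t, (s, u)) - g (t, (-s, u))) :=
    fun t s u => rfl
  obtain ⟨G, hG⟩ := hadamard (sc (swp ℝ ℝ ℝ) g') (fun q => by
    obtain ⟨s, u⟩ := q
    show g' (s, (0, u)) = 0
    rw [hg']; simp)
  have hG' : ∀ t s u, g' (t, (s, u)) = s * G (s, (t, u)) := fun t s u => hG s (t, u)
  have hfoG : ∀ t s u, fo (t, (s, u)) = t * (s * G (s, (t, u))) := by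
    intro t s u
    rw [← hG', hg']
    have h1 := hg t (s, u)
    have h2 := hg t (-s, u)
    rw [hfo, hfs', hfs', neg_neg] at h2
    rw [hfo] at h1 ⊢
    linear_combination (1 / 2) * h1 - (1 / 2) * h2
  let K : SchwartzMap (ℝ × (ℝ × ℝ)) ℂ := sc (swp ℝ ℝ ℝ) G
  have hfoK : ∀ t s u, fo (t, (s, u)) = t * (s * K (t, (s, u))) := hfoG
  let K' : SchwartzMap (ℝ × (ℝ × ℝ)) ℂ :=
    (1 / 4 : ℂ) • (K + sc N1 K + sc N2 K + sc N1 (sc N2 K))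
  have hK' : ∀ t s u, K' (t, (s, u)) = (1 / 4) * (K (t, (s, u)) + K (-t, (s, u)) +
    K (t, (-s, u)) + K (-t, (-s, u))) := fun t s u => rfl
  have hfoK' : ∀ t s u, fo (t, (s, u)) = t * (s * K' (t, (s, u))) := by
    intro t s u
    have h1 := hfoK t s u
    have h2 := hfoK (-t) s u
    have h3 := hfoK t (-s) u
    have h4 := hfoK (-t) (-s) u
    rw [hfo] at h1 h2 h3 h4 ⊢
    rw [hfs', hfs', neg_neg] at h3 h4
    rw [neg_neg] at h2
    rw [hK']
    push_cast at h1 h2 h3 h4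
    linear_combination (1 / 4) * h1 - (1 / 4) * h2 - (1 / 4) * h3 + (1 / 4) * h4
  have fe1 : ∀ t s u, fe (-t, (s, u)) = fe (t, (s, u)) := fun t s u => by
    rw [hfe, hfe, neg_neg, add_comm]
  have fe2 : ∀ t s u, fe (t, (-s, u)) = fe (t, (s, u)) := fun t s u => by
    rw [hfe, hfe, hfs', hfs', neg_neg, add_comm]
  have K1 : ∀ t s u, K' (-t, (s, u)) = K' (t, (s, u)) := fun t s u => by
    rw [hK', hK', neg_neg]; ring
  have K2 : ∀ t s u, K' (t, (-s, u)) = K' (t, (s, u)) := fun t s u => by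
    rw [hK', hK', neg_neg]; ring
  obtain ⟨ψ1, hψ1⟩ := lift_ee (E := E) fe fe1 fe2
  obtain ⟨ψ2, hψ2⟩ := lift_ee (E := E) K' K1 K2
  obtain ⟨ψ3, hψ3⟩ := mulTG (fun x : (ℝ × E) × E => ((inner ℝ x.1.2 x.2 : ℝ) : ℂ)) (by
    have := (ContinuousLinearMap.snd ℝ (ℝ × E) E).hasTemperateGrowth
    have h2 := ((ContinuousLinearMap.snd ℝ ℝ E).comp
      (ContinuousLinearMap.fst ℝ (ℝ × E) E)).hasTemperateGrowth
    have h3 := (innerSL ℝ (E := E)).bilinear_hasTemperateGrowth h2 this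
    exact Complex.ofRealCLM.hasTemperateGrowth.comp h3) ψ2
  refine ⟨ψ1 + ψ3, fun u t s ω hω => ?_⟩
  rw [SchwartzMap.add_apply, hψ3, hψ1, hψ2]
  have e1 : fe (|t|, (|s|, u)) = fe (t, (s, u)) := by
    rw [abs_even (f := fun t => fe (t, (|s|, u))) (fun t => fe1 _ _ _),
      abs_even (f := fun s => fe (t, (s, u))) (fun s => fe2 _ _ _)]
  have e2 : K' (|t|, (|s|, u)) = K' (t, (s, u)) := by
    rw [abs_even (f := fun t => K' (t, (|s|, u))) (fun t => K1 _ _ _),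
      abs_even (f := fun s => K' (t, (s, u))) (fun s => K2 _ _ _)]
  simp only [norm_smul, hω, mul_one, Real.norm_eq_abs, inner_smul_left, inner_smul_right,
    real_inner_self_eq_norm_sq]
  rw [e1, e2, ← hf]
  have := hfoK' t s u
  rw [hfo] at this
  rw [hfe]
  simp
  linear_combination -this

end lift
end part4

section part5
open scoped FourierTransform LineDeriv

section PF
variable {Q E : Type} [NormedAddCommGroup E] [InnerProductSpace ℝ E] [FiniteDimensional ℝ E]
  [NormedAddCommGroup Q] [NormedSpace ℝ Q] [FiniteDimensional ℝ Q]
  [MeasurableSpace E] [BorelSpace E]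

theorem tg_pair (q : Q) : (fun y : E => (q, y)).HasTemperateGrowth := by
  have h1 := (ContinuousLinearMap.inr ℝ Q E).hasTemperateGrowth
  have h2 := (Function.HasTemperateGrowth.const (E := E) ((q, 0) : Q × E)).add h1
  convert h2 using 1
  funext y; simp

def slice (φ : SchwartzMap (Q × E) ℂ) (q : Q) : SchwartzMap E ℂ :=
  SchwartzMap.compCLM ℝ (tg_pair q) ⟨1, 1, fun x => by
    have : ‖x‖ ≤ ‖(q, x)‖ := le_max_right _ _
    simp only [one_mul, pow_one]; linarith⟩ φ

theorem slice_apply (φ : SchwartzMap (Q × E) ℂ) (q : Q) (y : E) : slice φ q y = φ (q, y) := rfl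

/-- partial Fourier transform -/
def PF (φ : SchwartzMap (Q × E) ℂ) (x : Q × E) : ℂ :=
  ∫ y, Complex.exp (↑(-2 * Real.pi * inner ℝ y x.2) * Complex.I) * φ (x.1, y)

theorem PF_eq (φ : SchwartzMap (Q × E) ℂ) (x : Q × E) : PF φ x = 𝓕 (slice φ x.1) x.2 := by
  rw [SchwartzMap.fourier_coe, Real.fourier_eq']
  rfl

theorem schw_bound_y {F : Type} [NormedAddCommGroup F] [NormedSpace ℝ F]
    (φ : SchwartzMap (Q × E) F) (k : ℕ) :
    ∃ b : E → ℝ, Integrable b ∧ ∀ q y, (1 + ‖q‖) ^ k * ‖φ (q, y)‖ ≤ b y := by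
  obtain ⟨C, hC, h⟩ := schw_bound φ (k + (Module.finrank ℝ E + 1))
  have hr : (Module.finrank ℝ E : ℝ) < ((Module.finrank ℝ E + 1 : ℕ) : ℝ) := by simp
  refine ⟨fun y => C * (1 + ‖y‖) ^ (-((Module.finrank ℝ E + 1 : ℕ) : ℝ)),
    (integrable_one_add_norm hr).const_mul C, fun q y => ?_⟩
  have hy : 0 < 1 + ‖y‖ := by positivity
  beta_reduce
  rw [Real.rpow_neg hy.le, Real.rpow_natCast, ← div_eq_mul_inv, le_div_iff₀ (by positivity)]
  refine le_trans ?_ (h (q, y))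
  have h1 : ‖y‖ ≤ ‖(q, y)‖ := le_max_right _ _
  have h2 : ‖q‖ ≤ ‖(q, y)‖ := le_max_left _ _
  calc _ = (1 + ‖q‖) ^ k * (1 + ‖y‖) ^ (Module.finrank ℝ E + 1) * ‖φ (q, y)‖ := by ring
    _ ≤ (1 + ‖(q, y)‖) ^ k * (1 + ‖(q, y)‖) ^ (Module.finrank ℝ E + 1) * ‖φ (q, y)‖ := by gcongr
    _ = _ := by rw [← pow_add]

theorem norm_e (r : ℝ) : ‖Complex.exp (↑r * Complex.I)‖ = 1 := Complex.norm_exp_ofReal_mul_I r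

theorem PF_bound (φ : SchwartzMap (Q × E) ℂ) (k : ℕ) :
    ∃ C : ℝ, 0 ≤ C ∧ ∀ x, (1 + ‖x.1‖) ^ k * ‖PF φ x‖ ≤ C := by
  obtain ⟨b, hb, h⟩ := schw_bound_y φ k
  have hb0 : ∀ y, 0 ≤ b y := fun y => le_trans (by positivity) (h 0 y)
  refine ⟨∫ y, b y, integral_nonneg hb0, fun x => ?_⟩
  have h2 : (1 + ‖x.1‖) ^ k * ‖PF φ x‖ = ‖∫ y, (((1 + ‖x.1‖) ^ k : ℝ) : ℂ) *
      (Complex.exp (↑(-2 * Real.pi * inner ℝ y x.2) * Complex.I) * φ (x.1, y))‖ := by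
    rw [integral_const_mul, norm_mul, Complex.norm_real, Real.norm_of_nonneg (by positivity)]
    rfl
  rw [h2]
  refine norm_integral_le_of_norm_le hb (Eventually.of_forall fun y => ?_)
  rw [norm_mul, norm_mul, norm_e, one_mul, Complex.norm_real, Real.norm_of_nonneg (by positivity)]
  exact h _ _

theorem PF_add (φ ψ : SchwartzMap (Q × E) ℂ) (x : Q × E) : PF (φ + ψ) x = PF φ x + PF ψ x := by
  have : slice (φ + ψ) x.1 = slice φ x.1 + slice ψ x.1 := by ext; rfl
  rw [PF_eq, PF_eq, PF_eq, this, FourierTransform.fourier_add]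
  rfl

theorem PF_smul (c : ℂ) (φ : SchwartzMap (Q × E) ℂ) (x : Q × E) : PF (c • φ) x = c * PF φ x := by
  have : slice (c • φ) x.1 = c • slice φ x.1 := by ext; rfl
  rw [PF_eq, PF_eq, this, FourierTransform.fourier_smul]
  rfl

theorem PF_sum {ι : Type} (s : Finset ι) (φ : ι → SchwartzMap (Q × E) ℂ) (x : Q × E) :
    PF (∑ i ∈ s, φ i) x = ∑ i ∈ s, PF (φ i) x := by
  classical
  induction s using Finset.induction_on with
  | empty => simp [PF]
  | insert a s ha ih => rw [Finset.sum_insert ha, PF_add, ih, Finset.sum_insert ha]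

theorem PF_mul_inner (φ : SchwartzMap (Q × E) ℂ) (v : E) :
    ∃ ψ : SchwartzMap (Q × E) ℂ, ∀ x, PF ψ x = ((inner ℝ x.2 v : ℝ) : ℂ) * PF φ x := by
  let ψ : SchwartzMap (Q × E) ℂ :=
    SchwartzMap.evalCLM ℝ (Q × E) ℂ (0, v) (SchwartzMap.fderivCLM ℝ (Q × E) ℂ φ)
  refine ⟨(1 / (2 * Real.pi * Complex.I) : ℂ) • ψ, fun x => ?_⟩
  have h1 : slice ψ x.1 = ∂_{v} (slice φ x.1) := by
    ext y
    rw [SchwartzMap.lineDerivOp_apply_eq_fderiv]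
    have h3 : HasFDerivAt (fun y : E => (x.1, y)) (ContinuousLinearMap.inr ℝ Q E) y := by
      exact hasFDerivAt_prodMk_right _ _
    have h4 : HasFDerivAt (slice φ x.1) _ y := (φ.hasFDerivAt (x.1, y)).comp y h3
    rw [h4.fderiv]
    rfl
  rw [PF_smul, PF_eq, h1, SchwartzMap.fourier_lineDerivOp_eq, PF_eq]
  have : (fun y : E => inner ℝ y v).HasTemperateGrowth := by fun_prop
  rw [smul_apply, SchwartzMap.smulLeftCLM_apply_apply this]
  have hpi : (2 * Real.pi * Complex.I : ℂ) ≠ 0 := by simp [Real.pi_ne_zero]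
  simp only [smul_eq_mul, Complex.real_smul]
  field_simp

theorem PF_mul_one_add (φ : SchwartzMap (Q × E) ℂ) (k : ℕ) :
    ∃ ψ : SchwartzMap (Q × E) ℂ, ∀ x, PF ψ x = (((1 + ‖x.2‖ ^ 2) ^ k : ℝ) : ℂ) * PF φ x := by
  induction k with
  | zero => exact ⟨φ, fun x => by simp⟩
  | succ k ih =>
    obtain ⟨ψ, hψ⟩ := ih
    let b := stdOrthonormalBasis ℝ E
    choose ψ1 h1 using fun i => PF_mul_inner ψ (b i)
    choose ψ2 h2 using fun i => PF_mul_inner (ψ1 i) (b i)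
    refine ⟨ψ + ∑ i, ψ2 i, fun x => ?_⟩
    have hn : ∑ i, inner ℝ x.2 (b i) ^ 2 = ‖x.2‖ ^ 2 := b.sum_sq_inner_left x.2
    rw [PF_add, PF_sum, pow_succ]
    simp only [h2, h1, hψ]
    have hn' : ∑ i, ((inner ℝ x.2 (b i) : ℝ) : ℂ) ^ 2 = ((‖x.2‖ : ℝ) : ℂ) ^ 2 := by
      rw [← Complex.ofReal_pow, ← hn]; push_cast; rfl
    push_cast
    have h3 : ∀ X : ℂ, ∑ i, ((inner ℝ x.2 (b i) : ℝ) : ℂ) * (((inner ℝ x.2 (b i) : ℝ) : ℂ) * X) =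
        (∑ i, ((inner ℝ x.2 (b i) : ℝ) : ℂ) ^ 2) * X := fun X => by
      rw [Finset.sum_mul]
      refine Finset.sum_congr rfl fun i _ => ?_
      ring
    rw [h3, hn']
    ring

theorem PF_der (φ : SchwartzMap (Q × E) ℂ) :
    ∃ D : Q × E → Q × E →L[ℝ] ℂ, (∀ x, HasFDerivAt (PF φ) (D x) x) ∧
      ∀ v, ∃ ψ : SchwartzMap (Q × E) ℂ, ∀ x, D x v = PF ψ x := by
  obtain ⟨b, hb, h⟩ := schw_bound_y φ 0
  obtain ⟨b1, hb1, h1⟩ := schw_bound_y (SchwartzMap.fderivCLM ℝ _ ℂ φ) 0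
  have tgs : ∀ v : E, (fun y : Q × E => ((inner ℝ y.2 v : ℝ) : ℂ)).HasTemperateGrowth := by
    intro v
    have h9 := (Complex.ofRealCLM.comp ((innerSL ℝ v).comp
        (ContinuousLinearMap.snd ℝ Q E))).hasTemperateGrowth
    convert h9 using 1
    funext x
    simp [real_inner_comm]
  obtain ⟨b2, hb2, h2⟩ : ∃ b : E → ℝ, Integrable b ∧ ∀ q y, ‖y‖ * ‖φ (q, y)‖ ≤ b y := by
    let bb := stdOrthonormalBasis ℝ E
    choose ψ hψ using fun i => mulTG _ (tgs (bb i)) φ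
    choose b hb h using fun i => schw_bound_y (ψ i) 0
    refine ⟨fun y => ∑ i, b i y, integrable_finsetSum _ fun i _ => hb i, fun q y => ?_⟩
    have : ‖y‖ ≤ ∑ i, ‖inner ℝ y (bb i)‖ := by
      conv_lhs => rw [← bb.sum_repr' y]
      refine (norm_sum_le _ _).trans (Finset.sum_le_sum fun i _ => ?_)
      rw [norm_smul, bb.norm_eq_one, mul_one, real_inner_comm]
    refine (mul_le_mul_of_nonneg_right this (norm_nonneg _)).trans ?_
    rw [Finset.sum_mul]
    refine Finset.sum_le_sum fun i _ => ?_
    have := h i q y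
    rw [hψ, norm_mul, Complex.norm_real] at this
    simpa using this
  simp only [pow_zero, one_mul, SchwartzMap.fderivCLM_apply] at h h1
  let e : Q × E → E → ℂ := fun x y => Complex.exp (↑(-2 * Real.pi * inner ℝ y x.2) * Complex.I)
  let L : E → Q × E →L[ℝ] ℂ := fun y => ((-2 * Real.pi : ℂ) * Complex.I) •
    (Complex.ofRealCLM.comp ((innerSL ℝ y).comp (ContinuousLinearMap.snd ℝ Q E)))
  let D : Q × E → E → Q × E →L[ℝ] ℂ := fun x y =>
    e x y • ((fderiv ℝ φ (x.1, y)).comp ((ContinuousLinearMap.inl ℝ Q E).comp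
      (ContinuousLinearMap.fst ℝ Q E))) + φ (x.1, y) • (e x y • L y)
  have hLn : ∀ y, ‖L y‖ ≤ 2 * Real.pi * ‖y‖ := fun y => by
    refine ContinuousLinearMap.opNorm_le_bound _ (by positivity) fun v => ?_
    simp only [L, ContinuousLinearMap.smul_apply, ContinuousLinearMap.comp_apply,
      Complex.ofRealCLM_apply, ContinuousLinearMap.coe_snd', innerSL_apply_apply, norm_smul]
    have : ‖(-2 * Real.pi : ℂ) * Complex.I‖ = 2 * Real.pi := by
      simp [Real.pi_pos.le]
    rw [this, Complex.norm_real, mul_assoc (2 * Real.pi)]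
    refine mul_le_mul_of_nonneg_left ?_ (by positivity)
    refine (norm_inner_le_norm (𝕜 := ℝ) y v.2).trans ?_
    gcongr
    exact norm_snd_le v
  have hLc : Continuous L := by
    have : Continuous fun y : E => (Complex.ofRealCLM.comp ((innerSL ℝ y).comp
        (ContinuousLinearMap.snd ℝ Q E))) := by fun_prop
    exact Continuous.const_smul this ((-2 * Real.pi : ℂ) * Complex.I)
  have hec : ∀ x, Continuous (e x) := fun x => by
    simp only [e]; fun_prop
  have hpair : ∀ q : Q, Continuous fun y : E => (q, y) := fun q => by fun_prop
  have hfc : Continuous (fderiv ℝ φ) := (SchwartzMap.fderivCLM ℝ _ ℂ φ).continuous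
  have hDc : ∀ x, Continuous (D x) := fun x => by
    refine ((hec x).smul ((hfc.comp (hpair _)).clm_comp continuous_const)).add
      ((φ.continuous.comp (hpair _)).smul ((hec x).smul hLc))
  have hinl : ‖(ContinuousLinearMap.inl ℝ Q E).comp (ContinuousLinearMap.fst ℝ Q E)‖ ≤ 1 := by
    refine ContinuousLinearMap.opNorm_le_bound _ zero_le_one fun v => ?_
    simpa using norm_fst_le v
  have hDb : ∀ x y, ‖D x y‖ ≤ b1 y + 2 * Real.pi * b2 y := fun x y => by
    simp only [D]
    refine (ContinuousLinearMap.opNorm_add_le _ _).trans ?_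
    rw [norm_smul, norm_smul, norm_smul, norm_e, one_mul, one_mul]
    refine add_le_add ?_ ?_
    · refine (ContinuousLinearMap.opNorm_comp_le _ _).trans ?_
      refine (mul_le_of_le_one_right (norm_nonneg _) hinl).trans (h1 _ _)
    · have := h2 x.1 y
      calc _ ≤ ‖φ (x.1, y)‖ * (2 * Real.pi * ‖y‖) := by gcongr; exact hLn y
        _ = 2 * Real.pi * (‖y‖ * ‖φ (x.1, y)‖) := by ring
        _ ≤ _ := by gcongr
  have hbi : Integrable (fun y => b1 y + 2 * Real.pi * b2 y) := hb1.add (hb2.const_mul _)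
  refine ⟨fun x => ∫ y, D x y, ?_, ?_⟩
  · refine paramD volume (fun x y => e x y * φ (x.1, y)) D ?_ hDc b _ hb hbi ?_ hDb ?_
    · exact fun x => (hec x).mul (φ.continuous.comp (hpair _))
    · intro x y
      rw [norm_mul, norm_e, one_mul]
      exact h _ _
    · intro x y
      have d1 : HasFDerivAt (fun x : Q × E => e x y) (e x y • L y) x := by
        have : HasFDerivAt (fun x : Q × E => (↑(-2 * Real.pi * inner ℝ y x.2) * Complex.I : ℂ))
            (L y) x := by
          convert (L y).hasFDerivAt (x := x) using 1
          funext z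
          simp [L]
          ring
        exact this.cexp
      have d2 : HasFDerivAt (fun x : Q × E => φ (x.1, y)) ((fderiv ℝ φ (x.1, y)).comp
          ((ContinuousLinearMap.inl ℝ Q E).comp (ContinuousLinearMap.fst ℝ Q E))) x := by
        have : HasFDerivAt (fun x : Q × E => (x.1, y))
            ((ContinuousLinearMap.inl ℝ Q E).comp (ContinuousLinearMap.fst ℝ Q E)) x := by
          have := (hasFDerivAt_prodMk_left x.1 y).comp x
            (ContinuousLinearMap.fst ℝ Q E).hasFDerivAt
          exact this
        exact (φ.hasFDerivAt (x.1, y)).comp x this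
      exact d1.mul d2
  · intro v
    obtain ⟨ψ1, hψ1⟩ := mulTG _ (tgs v.2) φ
    let ψ : SchwartzMap (Q × E) ℂ :=
      SchwartzMap.evalCLM ℝ (Q × E) ℂ (v.1, 0) (SchwartzMap.fderivCLM ℝ (Q × E) ℂ φ)
    have hψ : ∀ x, ψ x = fderiv ℝ φ x (v.1, 0) := fun x => rfl
    refine ⟨ψ + ((-2 * Real.pi : ℂ) * Complex.I) • ψ1, fun x => ?_⟩
    rw [paramD_apply volume _ (hDc x) _ hbi (hDb x) v]
    unfold PF
    congr 1
    funext y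
    have h8 : (ψ + ((-2 * Real.pi : ℂ) * Complex.I) • ψ1) (x.1, y) = ψ (x.1, y) +
      ((-2 * Real.pi : ℂ) * Complex.I) * ψ1 (x.1, y) := rfl
    rw [h8, hψ1, hψ]
    simp [D, e, L]
    ring

theorem PF_schwartz (φ : SchwartzMap (Q × E) ℂ) :
    ∃ ψ : SchwartzMap (Q × E) ℂ, ∀ x, ψ x = PF φ x := by
  refine coS (Set.range PF) ?_ ?_ (PF φ) ⟨φ, rfl⟩
  · rintro _ ⟨φ, rfl⟩ k
    obtain ⟨ψ, hψ⟩ := PF_mul_one_add φ k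
    obtain ⟨C, hC, h⟩ := PF_bound ψ k
    refine ⟨C, fun x => le_trans ?_ (h x)⟩
    rw [hψ, norm_mul, Complex.norm_real, Real.norm_of_nonneg (by positivity), ← mul_assoc,
      ← mul_pow]
    gcongr
    rw [Prod.norm_def]
    have := norm_nonneg x.1
    have := norm_nonneg x.2
    refine max_le ?_ ?_
    · nlinarith [sq_nonneg ‖x.2‖, mul_nonneg this (sq_nonneg ‖x.2‖),
        mul_nonneg (norm_nonneg x.1) (sq_nonneg ‖x.2‖)]
    · nlinarith [sq_nonneg (‖x.2‖ - 1), mul_nonneg (norm_nonneg x.1) (sq_nonneg ‖x.2‖)]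
  · rintro _ ⟨φ, rfl⟩
    obtain ⟨D, h1, h2⟩ := PF_der φ
    refine ⟨D, h1, fun v => ?_⟩
    obtain ⟨ψ, hψ⟩ := h2 v
    exact Submodule.subset_span ⟨ψ, funext fun x => (hψ x).symm⟩

theorem PF_surj (φ : SchwartzMap (Q × E) ℂ) :
    ∃ ψ : SchwartzMap (Q × E) ℂ, ∀ x, PF ψ x = φ x := by
  obtain ⟨ψ0, h0⟩ := PF_schwartz φ
  let N : (Q × E) ≃L[ℝ] (Q × E) :=
    (ContinuousLinearEquiv.refl ℝ Q).prodCongr (ContinuousLinearEquiv.neg ℝ)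
  refine ⟨sc N ψ0, fun x => ?_⟩
  have : slice (sc N ψ0) x.1 = 𝓕⁻ (slice φ x.1) := by
    ext y
    show ψ0 (x.1, -y) = _
    rw [h0, PF_eq, SchwartzMap.fourierInv_coe, Real.fourierInv_eq_fourier_neg]
    rfl
  rw [PF_eq, this, FourierTransform.fourier_fourierInv_eq]
  rfl

end PF
end part5

section part6
open scoped FourierTransform

section polar
variable {E : Type} [NormedAddCommGroup E] [InnerProductSpace ℝ E] [FiniteDimensional ℝ E]
  [MeasurableSpace E] [BorelSpace E] [Nontrivial E]

theorem polar (f : E → ℂ) (hf : Integrable f) :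
    ∫ z, f z = ∫ t in Set.Ioi (0 : ℝ), ((t ^ (Module.finrank ℝ E - 1) : ℝ) : ℂ) *
      ∫ ω : Metric.sphere (0 : E) 1, f (t • (ω : E)) ∂(volume : Measure E).toSphere := by
  let μ : Measure E := volume
  let n := Module.finrank ℝ E - 1
  have hemb : MeasurableEmbedding (homeomorphUnitSphereProd E) := Homeomorph.measurableEmbedding _
  let k : Metric.sphere (0 : E) 1 × Set.Ioi (0 : ℝ) → ℂ := fun p => f (p.2.1 • (p.1 : E))
  have hk : ∀ x : ({0}ᶜ : Set E), k (homeomorphUnitSphereProd E x) = f x := by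
    intro x
    obtain ⟨x, hx⟩ := x
    have hx' : ‖x‖ ≠ 0 := by simpa using hx
    simp only [k]
    congr 1
    simp [hx', smul_smul]
  have hki : Integrable k (μ.toSphere.prod (Measure.volumeIoiPow n)) := by
    rw [← μ.measurePreserving_homeomorphUnitSphereProd.integrable_comp_emb hemb]
    have : k ∘ (homeomorphUnitSphereProd E) = f ∘ Subtype.val := funext hk
    rw [this, ← integrableOn_iff_comap_subtypeVal (by measurability), IntegrableOn,
      restrict_compl_singleton]
    exact hf
  calc ∫ z, f z = ∫ x : ({(0)}ᶜ : Set E), f x.1 ∂(μ.comap (↑)) := by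
        rw [integral_subtype_comap (measurableSet_singleton _).compl fun x ↦ f x,
          restrict_compl_singleton]
    _ = ∫ p, k p ∂(μ.toSphere.prod (Measure.volumeIoiPow n)) := by
        rw [← μ.measurePreserving_homeomorphUnitSphereProd.integral_comp hemb]
        simp only [hk]
    _ = ∫ t : Set.Ioi (0 : ℝ), ∫ ω, k (ω, t) ∂μ.toSphere ∂Measure.volumeIoiPow n :=
        integral_prod_symm _ hki
    _ = _ := by
      rw [Measure.volumeIoiPow, integral_withDensity_eq_integral_toReal_smul (by fun_prop)
        (by simp), ← integral_subtype_comap measurableSet_Ioi]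
      congr 1
      funext t
      rw [ENNReal.toReal_ofReal (pow_nonneg (le_of_lt t.2) _), Complex.real_smul]

theorem J_eq {Q : Type} [NormedAddCommGroup Q] [NormedSpace ℝ Q] [FiniteDimensional ℝ Q]
    (g : SchwartzMap ℝ ℂ) (φ : SchwartzMap (Q × E) ℂ) (a : ℝ) (q : Q) (w : E) :
    ∫ y, g (a + inner ℝ y w) * φ (q, y) =
      ∫ l : ℝ, (𝓕 g l * Complex.exp (↑(2 * Real.pi * l * a) * Complex.I)) * PF φ (q, (-l) • w) := by
  have hg : ∀ ξ, g ξ = ∫ l : ℝ, Complex.exp (↑(2 * Real.pi * (l * ξ)) * Complex.I) * 𝓕 g l := by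
    intro ξ
    have : g ξ = (𝓕⁻ (𝓕 g)) ξ := by rw [FourierTransform.fourierInv_fourier_eq]
    rw [this, SchwartzMap.fourierInv_coe, Real.fourierInv_eq']
    congr 1
    funext l
    simp [mul_comm]
  have hgi : Integrable (𝓕 g : SchwartzMap ℝ ℂ) := (𝓕 g : SchwartzMap ℝ ℂ).integrable
  have hφi : Integrable (slice φ q) := (slice φ q).integrable
  let K : E → ℝ → ℂ := fun y l =>
    Complex.exp (↑(2 * Real.pi * (l * (a + inner ℝ y w))) * Complex.I) * (slice φ q y * 𝓕 g l)
  have hK : Integrable (Function.uncurry K) (volume.prod volume) := by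
    refine (hφi.mul_prod hgi).mono ?_ (Eventually.of_forall fun p => ?_)
    · refine Continuous.aestronglyMeasurable ?_
      have h1 := (slice φ q).continuous
      have h2 := (𝓕 g : SchwartzMap ℝ ℂ).continuous
      simp only [K, Function.uncurry_def]
      fun_prop
    · simp only [K, Function.uncurry_def]
      rw [norm_mul, norm_e, one_mul]
  calc ∫ y, g (a + inner ℝ y w) * φ (q, y) = ∫ y, ∫ l, K y l := by
        congr 1
        funext y
        rw [hg, ← integral_mul_const]
        congr 1
        funext l
        simp only [K, slice_apply]
        ring
    _ = ∫ l, ∫ y, K y l := integral_integral_swap hK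
    _ = _ := by
        congr 1
        funext l
        unfold PF
        rw [← integral_const_mul]
        congr 1
        funext y
        simp only [K, slice_apply, inner_smul_right]
        have : Complex.exp (↑(2 * Real.pi * (l * (a + inner ℝ y w))) * Complex.I) =
          Complex.exp (↑(2 * Real.pi * l * a) * Complex.I) *
            Complex.exp (↑(-2 * Real.pi * (-l * inner ℝ y w)) * Complex.I) := by
          rw [← Complex.exp_add]
          congr 1
          push_cast
          ring
        rw [this]
        ring

end polar
end part6

section part7
open scoped FourierTransform

section key
variable {E : Type} [NormedAddCommGroup E] [InnerProductSpace ℝ E] [FiniteDimensional ℝ E]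
  [MeasurableSpace E] [BorelSpace E] [Nontrivial E]

theorem int_ioi (f : ℝ → ℂ) (hf : Integrable f) :
    ∫ t, f t = ∫ t in Set.Ioi (0 : ℝ), (f t + f (-t)) := by
  rw [integral_add hf.integrableOn hf.comp_neg.integrableOn, integral_comp_neg_Ioi, neg_zero,
    add_comm, intervalIntegral.integral_Iic_add_Ioi hf.integrableOn hf.integrableOn]

instance haarP {X Y : Type} [NormedAddCommGroup X] [NormedSpace ℝ X] [FiniteDimensional ℝ X]
    [MeasureSpace X] [BorelSpace X] [(volume : Measure X).IsAddHaarMeasure]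
    [NormedAddCommGroup Y] [NormedSpace ℝ Y] [FiniteDimensional ℝ Y]
    [MeasureSpace Y] [BorelSpace Y] [(volume : Measure Y).IsAddHaarMeasure] :
    (volume : Measure (X × Y)).IsAddHaarMeasure :=
  inferInstanceAs ((volume : Measure X).prod (volume : Measure Y)).IsAddHaarMeasure

/-- weighted integrability -/
theorem wint {X : Type} [NormedAddCommGroup X] [NormedSpace ℝ X] [FiniteDimensional ℝ X]
    [MeasureSpace X] [BorelSpace X] [(volume : Measure X).IsAddHaarMeasure]
    (φ : SchwartzMap X ℂ) (n : ℕ) (w : X → ℂ) (hw : Continuous w) (M : ℝ)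
    (hwb : ∀ x, ‖w x‖ ≤ M * ‖x‖ ^ n) : Integrable fun x => w x * φ x := by
  refine ((φ.integrable_pow_mul volume n).const_mul M).mono'
    (hw.mul φ.continuous).aestronglyMeasurable (Eventually.of_forall fun x => ?_)
  rw [norm_mul, ← mul_assoc]
  gcongr
  exact hwb x

theorem key_inner (φ : SchwartzMap ((ℝ × E) × E) ℂ) (φ₂ : SchwartzMap ((ℝ × ℝ) × ℝ) ℂ)
    (h : ∀ u t s, ∫ ω : Metric.sphere (0 : E) 1, (PF φ ((u, t • (ω : E)), s • (ω : E)) +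
        PF φ ((u, (-t) • (ω : E)), (-s) • (ω : E))) ∂(volume : Measure E).toSphere =
      2 * (PF φ₂ ((u, t), s) + PF φ₂ ((u, -t), -s)))
    (g : SchwartzMap ℝ ℂ) (u t : ℝ) :
    ∫ ω : Metric.sphere (0 : E) 1,
        ((∫ y, g (u ^ 2 + inner ℝ y (t • (ω : E))) * φ ((u, t • (ω : E)), y)) +
        ∫ y, g (u ^ 2 + inner ℝ y ((-t) • (ω : E))) * φ ((u, (-t) • (ω : E)), y))
          ∂(volume : Measure E).toSphere =
      2 * ((∫ v, g (u ^ 2 + inner ℝ v t) * φ₂ ((u, t), v)) +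
        ∫ v, g (u ^ 2 + inner ℝ v (-t)) * φ₂ ((u, -t), v)) := by
  obtain ⟨F, hF⟩ := PF_schwartz φ
  obtain ⟨F₂, hF₂⟩ := PF_schwartz φ₂
  obtain ⟨C, hC, hCF⟩ := schw_bound F 0
  obtain ⟨C2, hC2, hCF2⟩ := schw_bound F₂ 0
  simp only [pow_zero, one_mul] at hCF hCF2
  let σ : Measure (Metric.sphere (0 : E) 1) := (volume : Measure E).toSphere
  let c : ℝ → ℂ := fun l => 𝓕 g l * Complex.exp (((2 * Real.pi * l * u ^ 2 : ℝ) : ℂ) * Complex.I)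
  have hgi : Integrable (𝓕 g : SchwartzMap ℝ ℂ) := (𝓕 g : SchwartzMap ℝ ℂ).integrable
  have hcc : Continuous c := by
    have h2 := (𝓕 g : SchwartzMap ℝ ℂ).continuous
    simp only [c]
    fun_prop
  have hcn : ∀ l, ‖c l‖ = ‖𝓕 g l‖ := fun l => by simp only [c]; rw [norm_mul, norm_e, mul_one]
  have hci : Integrable c := hgi.mono hcc.aestronglyMeasurable
    (Eventually.of_forall fun l => (hcn l).le)
  have hint : ∀ {Y : Type} [NormedAddCommGroup Y] [NormedSpace ℝ Y] (H : SchwartzMap Y ℂ)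
      (p : ℝ → Y), Continuous p → Integrable (fun l => c l * H (p l)) := by
    intro Y _ _ H p hp
    obtain ⟨M, hM, hMH⟩ := schw_bound H 0
    simp only [pow_zero, one_mul] at hMH
    exact hci.mul_bdd (c := M) (H.continuous.comp hp).aestronglyMeasurable
      (Eventually.of_forall fun l => hMH _)
  simp only [J_eq, ← hF, ← hF₂]
  simp only [← hF, ← hF₂] at h
  have e1 : ∀ ω : Metric.sphere (0 : E) 1,
      (∫ l, c l * F ((u, t • (ω : E)), (-l) • t • (ω : E))) +
        (∫ l, c l * F ((u, (-t) • (ω : E)), (-l) • (-t) • (ω : E))) =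
      ∫ l, c l * (F ((u, t • (ω : E)), (-l * t) • (ω : E)) +
        F ((u, (-t) • (ω : E)), (-(-l * t)) • (ω : E))) := by
    intro ω
    rw [← integral_add (hint F _ (by fun_prop)) (hint F _ (by fun_prop))]
    congr 1
    funext l
    rw [smul_smul, smul_smul, mul_add, mul_neg]
  have e2 : (∫ l, c l * F₂ ((u, t), (-l) • t)) + (∫ l, c l * F₂ ((u, -t), (-l) • (-t))) =
      ∫ l, c l * (F₂ ((u, t), (-l * t)) + F₂ ((u, -t), (-(-l * t)))) := by
    rw [← integral_add (hint F₂ _ (by fun_prop)) (hint F₂ _ (by fun_prop))]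
    congr 1
    funext l
    rw [smul_eq_mul, smul_eq_mul, mul_add, mul_neg]
  change _ = 2 * ((∫ l, c l * F₂ ((u, t), (-l) • t)) + (∫ l, c l * F₂ ((u, -t), (-l) • (-t))))
  rw [e2, ← integral_const_mul]
  calc _ = ∫ ω, ∫ l, c l * (F ((u, t • (ω : E)), (-l * t) • (ω : E)) +
        F ((u, (-t) • (ω : E)), (-(-l * t)) • (ω : E))) ∂volume ∂σ := by
        congr 1
        funext ω
        exact e1 ω
    _ = ∫ l, ∫ ω, c l * (F ((u, t • (ω : E)), (-l * t) • (ω : E)) +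
        F ((u, (-t) • (ω : E)), (-(-l * t)) • (ω : E))) ∂σ ∂volume := by
        refine integral_integral_swap ?_
        refine Integrable.mono' (g := fun p => (2 * C) * ‖c p.2‖) ?_ ?_ ?_
        · exact (integrable_const (μ := σ) (2 * C)).mul_prod hci.norm
        · refine Continuous.aestronglyMeasurable ?_
          have := F.continuous
          simp only [Function.uncurry_def]
          fun_prop
        · refine Eventually.of_forall fun p => ?_
          simp only [Function.uncurry_def]
          rw [norm_mul, mul_comm]
          gcongr
          refine (norm_add_le _ _).trans ?_
          have := hCF ((u, t • (p.1 : E)), (-p.2 * t) • (p.1 : E))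
          have := hCF ((u, (-t) • (p.1 : E)), (-(-p.2 * t)) • (p.1 : E))
          linarith
    _ = _ := by
        congr 1
        funext l
        rw [integral_const_mul, h]
        simp only [c]
        ring

theorem key_schwartz (φ : SchwartzMap ((ℝ × E) × E) ℂ) (φ₂ : SchwartzMap ((ℝ × ℝ) × ℝ) ℂ)
    (h : ∀ u t s, ∫ ω : Metric.sphere (0 : E) 1, (PF φ ((u, t • (ω : E)), s • (ω : E)) +
        PF φ ((u, (-t) • (ω : E)), (-s) • (ω : E))) ∂(volume : Measure E).toSphere =
      2 * (PF φ₂ ((u, t), s) + PF φ₂ ((u, -t), -s)))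
    (g : SchwartzMap ℝ ℂ) :
    ∫ x : (ℝ × E) × E, g (x.1.1 ^ 2 + inner ℝ x.2 x.1.2) * φ x =
      ∫ x : (ℝ × ℝ) × ℝ, g (x.1.1 ^ 2 + inner ℝ x.2 x.1.2) *
        (((|x.1.2| ^ (Module.finrank ℝ E - 1) : ℝ) : ℂ) * φ₂ x) := by
  obtain ⟨C, hC, hCg⟩ := schw_bound g 0
  simp only [pow_zero, one_mul] at hCg
  have hgc := g.continuous
  let n := Module.finrank ℝ E - 1
  have i1 : Integrable fun x : (ℝ × E) × E => g (x.1.1 ^ 2 + inner ℝ x.2 x.1.2) * φ x :=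
    wint φ 0 _ (by fun_prop) C (fun x => by simpa using hCg _)
  have i2 : Integrable fun x : (ℝ × ℝ) × ℝ => g (x.1.1 ^ 2 + inner ℝ x.2 x.1.2) *
        (((|x.1.2| ^ n : ℝ) : ℂ) * φ₂ x) := by
    have := wint φ₂ n (fun x => g (x.1.1 ^ 2 + inner ℝ x.2 x.1.2) * ((|x.1.2| ^ n : ℝ) : ℂ))
      (by fun_prop) C (fun x => by
        rw [norm_mul, Complex.norm_real, norm_pow, Real.norm_eq_abs, abs_abs]
        gcongr
        · exact hCg _
        · exact (norm_snd_le x.1).trans (norm_fst_le x))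
    simpa only [mul_assoc] using this
  have j1 := i1.integral_prod_left
  have j2 := i2.integral_prod_left
  rw [Measure.volume_eq_prod, integral_prod _ i1, Measure.volume_eq_prod ℝ E, integral_prod _ j1]
  rw [Measure.volume_eq_prod (ℝ × ℝ) ℝ, integral_prod _ i2, Measure.volume_eq_prod ℝ ℝ,
    integral_prod _ j2]
  refine integral_congr_ae ?_
  filter_upwards [j1.prod_right_ae, j2.prod_right_ae] with u k1 k2
  rw [int_ioi _ k2]
  have k1' := k1.comp_neg
  have s1 : ∀ J : E → ℂ, Integrable J → ∫ z, J z = (1 / 2) * ∫ z, (J z + J (-z)) := by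
    intro J hJ
    rw [integral_add hJ hJ.comp_neg, integral_neg_eq_self]
    ring
  let J : E → ℂ := fun z => ∫ y, g (u ^ 2 + inner ℝ y z) * φ ((u, z), y)
  have hp := polar (fun z => J z + J (-z)) (k1.add k1')
  change ∫ z, J z = _
  rw [s1 J k1, hp, ← integral_const_mul]
  refine setIntegral_congr_fun measurableSet_Ioi fun t ht => ?_
  have ht' : (0 : ℝ) < t := ht
  have := key_inner φ φ₂ h g u t
  simp only [neg_smul] at this
  simp only [Pi.add_apply, abs_neg, abs_of_pos ht']
  have e3 : ∀ t' : ℝ, ∫ y, g (u ^ 2 + inner ℝ y t') * (((t ^ n : ℝ) : ℂ) * φ₂ ((u, t'), y)) =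
      ((t ^ n : ℝ) : ℂ) * ∫ y, g (u ^ 2 + inner ℝ y t') * φ₂ ((u, t'), y) := by
    intro t'
    rw [← integral_const_mul]
    congr 1; funext y; ring
  rw [e3, e3, this]
  ring

end key
end part7

section part8
section ex
variable {E : Type} [NormedAddCommGroup E] [InnerProductSpace ℝ E] [FiniteDimensional ℝ E]
  [MeasurableSpace E] [BorelSpace E] [Nontrivial E]

/-- the matching condition -/
def Mat (φ : SchwartzMap ((ℝ × E) × E) ℂ) (φ₂ : SchwartzMap ((ℝ × ℝ) × ℝ) ℂ) : Prop :=
  ∀ u t s, ∫ ω : Metric.sphere (0 : E) 1, (PF φ ((u, t • (ω : E)), s • (ω : E)) +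
        PF φ ((u, (-t) • (ω : E)), (-s) • (ω : E))) ∂(volume : Measure E).toSphere =
      2 * (PF φ₂ ((u, t), s) + PF φ₂ ((u, -t), -s))

theorem mat_ex1 (φ : SchwartzMap ((ℝ × E) × E) ℂ) : ∃ φ₂, Mat φ φ₂ := by
  obtain ⟨F, hF⟩ := PF_schwartz φ
  obtain ⟨ψ, hψ⟩ := sphere_avg (volume : Measure E).toSphere F
  obtain ⟨φ₂, h2⟩ := PF_surj ((1 / 2 : ℂ) • ψ)
  refine ⟨φ₂, fun u t s => ?_⟩
  simp only [← hF, h2, smul_apply, hψ]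
  have hi : ∀ t s : ℝ, Integrable (fun ω : Metric.sphere (0 : E) 1 =>
      F ((u, t • (ω : E)), s • (ω : E))) (volume : Measure E).toSphere := by
    intro t s
    have hc := F.continuous
    exact Continuous.integrable_of_hasCompactSupport (by fun_prop)
      (HasCompactSupport.of_compactSpace _)
  rw [integral_add (hi _ _) (hi _ _)]
  simp only [smul_eq_mul]
  ring

theorem mat_ex2 (φ₂ : SchwartzMap ((ℝ × ℝ) × ℝ) ℂ) :
    ∃ φ : SchwartzMap ((ℝ × E) × E) ℂ, Mat φ φ₂ := by
  obtain ⟨F₂, hF₂⟩ := PF_schwartz φ₂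
  let N : ((ℝ × ℝ) × ℝ) ≃L[ℝ] ((ℝ × ℝ) × ℝ) :=
    ((ContinuousLinearEquiv.refl ℝ ℝ).prodCongr (ContinuousLinearEquiv.neg ℝ)).prodCongr
      (ContinuousLinearEquiv.neg ℝ)
  let G : SchwartzMap ((ℝ × ℝ) × ℝ) ℂ := F₂ + sc N F₂
  have hG : ∀ u t s, G ((u, t), s) = F₂ ((u, t), s) + F₂ ((u, -t), -s) := fun u t s => rfl
  obtain ⟨F, hF⟩ := lift (E := E) G (fun u t s => by rw [hG, hG, neg_neg, neg_neg, add_comm])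
  let m : ℝ := (volume : Measure E).toSphere.real Set.univ
  have hm : m ≠ 0 := by
    have := Measure.toSphere_ne_zero (volume : Measure E)
    rw [measureReal_ne_zero_iff]
    exact Measure.measure_univ_ne_zero.mpr this
  obtain ⟨φ, h2⟩ := PF_surj ((1 / m : ℂ) • F)
  refine ⟨φ, fun u t s => ?_⟩
  simp only [h2, smul_apply, ← hF₂]
  have : ∀ ω : Metric.sphere (0 : E) 1, ‖(ω : E)‖ = 1 := fun ω => by simp
  simp only [hF _ _ _ _ (this _), hG, neg_neg, integral_const]
  have hm' : (m : ℂ) ≠ 0 := by exact_mod_cast hm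
  simp only [smul_eq_mul, Complex.real_smul]
  change (m : ℂ) * _ = _
  field_simp
  ring

theorem approx (g : ℝ → ℂ) (hg : Continuous g) (hs : HasCompactSupport g) (ε : ℝ) (hε : 0 < ε) :
    ∃ γ : SchwartzMap ℝ ℂ, ∀ x, ‖g x - γ x‖ ≤ ε := by
  have hu := hs.uniformContinuous_of_continuous hg
  obtain ⟨δ, hδ, hd⟩ := Metric.uniformContinuous_iff.mp hu ε hε
  obtain ⟨γ, hγ, hb⟩ := hg.exists_contDiff_dist_le_of_forall_mem_ball_dist_le hδ
  have hc : HasCompactSupport γ := by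
    refine HasCompactSupport.of_support_subset_isCompact (hs.isCompact.cthickening (r := δ)) ?_
    intro x hx
    by_contra hn
    apply hx
    have hz : ∀ y ∈ Metric.ball x δ, g y = 0 := by
      intro y hy
      by_contra h0
      exact hn (Metric.mem_cthickening_of_dist_le x y δ _ (subset_tsupport g h0)
        (by rw [dist_comm]; exact (Metric.mem_ball.mp hy).le))
    have h1 := hz x (Metric.mem_ball_self hδ)
    have := hb x 0 (fun y hy => by rw [hz y hy, h1, dist_self])
    rw [h1] at this
    exact dist_le_zero.mp this
  refine ⟨hc.toSchwartzMap hγ, fun x => ?_⟩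
  rw [← dist_eq_norm, dist_comm]
  exact hb x ε (fun y hy => (hd hy).le)

theorem cc_ext {X Y : Type} [TopologicalSpace X] [TopologicalSpace Y] [SecondCountableTopology X]
    [SecondCountableTopology Y] [MeasurableSpace X]
    [MeasurableSpace Y] [BorelSpace X] [BorelSpace Y] (μ : Measure X) (ν : Measure Y)
    (w1 : X → ℂ) (w2 : Y → ℂ) (h1 : Integrable w1 μ) (h2 : Integrable w2 ν)
    (q1 : X → ℝ) (q2 : Y → ℝ) (hq1 : Continuous q1) (hq2 : Continuous q2)
    (H : ∀ γ : SchwartzMap ℝ ℂ, ∫ x, γ (q1 x) * w1 x ∂μ = ∫ y, γ (q2 y) * w2 y ∂ν)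
    (g : ℝ → ℂ) (hg : Continuous g) (hs : HasCompactSupport g) :
    ∫ x, g (q1 x) * w1 x ∂μ = ∫ y, g (q2 y) * w2 y ∂ν := by
  have aux : ∀ {Z : Type} [TopologicalSpace Z] [SecondCountableTopology Z]
      [MeasurableSpace Z] [BorelSpace Z] (ρ : Measure Z) (w : Z → ℂ) (_ : Integrable w ρ)
      (q : Z → ℝ) (_ : Continuous q) (ε : ℝ) (γ : SchwartzMap ℝ ℂ), (∀ x, ‖g x - γ x‖ ≤ ε) →
      ‖∫ x, g (q x) * w x ∂ρ - ∫ x, γ (q x) * w x ∂ρ‖ ≤ ε * ∫ x, ‖w x‖ ∂ρ := by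
    intro Z _ _ _ _ ρ w hw q hq ε γ hγ
    obtain ⟨M, hM⟩ := hg.bounded_above_of_compact_support hs
    obtain ⟨M', _, hM'⟩ := schw_bound γ 0
    simp only [pow_zero, one_mul] at hM'
    have b1 : Integrable (fun x => g (q x) * w x) ρ :=
      hw.bdd_mul (c := M) (hg.comp hq).aestronglyMeasurable (Eventually.of_forall fun _ => hM _)
    have b2 : Integrable (fun x => γ (q x) * w x) ρ :=
      hw.bdd_mul (c := M') (γ.continuous.comp hq).aestronglyMeasurable
        (Eventually.of_forall fun _ => hM' _)
    rw [← integral_sub b1 b2, ← integral_const_mul]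
    refine norm_integral_le_of_norm_le (hw.norm.const_mul ε) (Eventually.of_forall fun x => ?_)
    rw [← sub_mul, norm_mul]
    gcongr
    exact hγ _
  rw [← sub_eq_zero, ← norm_le_zero_iff]
  refine le_of_forall_pos_le_add fun η hη => ?_
  set A := (∫ x, ‖w1 x‖ ∂μ) + ∫ x, ‖w2 x‖ ∂ν with hA
  have hA0 : 0 ≤ A := by positivity
  obtain ⟨γ, hγ⟩ := approx g hg hs (η / (A + 1)) (by positivity)
  have a1 := aux μ w1 h1 q1 hq1 _ γ hγ
  have a2 := aux ν w2 h2 q2 hq2 _ γ hγ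
  rw [H γ] at a1
  have := norm_sub_le_norm_sub_add_norm_sub (∫ x, g (q1 x) * w1 x ∂μ)
    (∫ y, γ (q2 y) * w2 y ∂ν) (∫ y, g (q2 y) * w2 y ∂ν)
  rw [norm_sub_rev (∫ y, γ (q2 y) * w2 y ∂ν)] at this
  have h3 : η / (A + 1) * (∫ x, ‖w1 x‖ ∂μ) + η / (A + 1) * (∫ x, ‖w2 x‖ ∂ν) ≤ η := by
    rw [← mul_add, ← hA, div_mul_eq_mul_div, div_le_iff₀ (by positivity)]
    nlinarith
  linarith

theorem key_cc (φ : SchwartzMap ((ℝ × E) × E) ℂ) (φ₂ : SchwartzMap ((ℝ × ℝ) × ℝ) ℂ)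
    (h : Mat φ φ₂) (g : ℝ → ℂ) (hg : Continuous g) (hs : HasCompactSupport g) :
    ∫ x : (ℝ × E) × E, g (x.1.1 ^ 2 + inner ℝ x.2 x.1.2) * φ x =
      ∫ x : (ℝ × ℝ) × ℝ, g (x.1.1 ^ 2 + inner ℝ x.2 x.1.2) *
        (((|x.1.2| ^ (Module.finrank ℝ E - 1) : ℝ) : ℂ) * φ₂ x) := by
  refine cc_ext volume volume (fun x => φ x) (fun x : (ℝ × ℝ) × ℝ =>
    (((|x.1.2| ^ (Module.finrank ℝ E - 1) : ℝ) : ℂ) * φ₂ x)) φ.integrable ?_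
    (fun x => x.1.1 ^ 2 + inner ℝ x.2 x.1.2) (fun x => x.1.1 ^ 2 + inner ℝ x.2 x.1.2)
    (by fun_prop) (by fun_prop) (fun γ => key_schwartz φ φ₂ h γ) g hg hs
  refine wint φ₂ (Module.finrank ℝ E - 1) _ (by fun_prop) 1 (fun x => ?_)
  rw [Complex.norm_real, norm_pow, Real.norm_eq_abs, abs_abs, one_mul]
  gcongr
  exact (norm_snd_le x.1).trans (norm_fst_le x)

end ex
end part8

section part9
theorem sqrt_int (a : ℝ) : Integrable fun t : ℝ => (√|t - a|)⁻¹ * (1 + t ^ 2)⁻¹ := by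
  let H : ℝ → ℝ := (Set.Ioc (0 : ℝ) 1).indicator (fun x => x ^ (-(1 / 2) : ℝ))
  have hH : Integrable H := by
    have h := (intervalIntegral.intervalIntegrable_rpow' (a := 0) (b := 1)
      (r := -(1 / 2)) (by norm_num))
    rw [intervalIntegrable_iff_integrableOn_Ioc_of_le zero_le_one] at h
    exact h.integrable_indicator measurableSet_Ioc
  have hH1 : Integrable fun t => H (t - a) := hH.comp_sub_right a
  have hH2 : Integrable fun t => H (-(t - a)) := hH.comp_neg.comp_sub_right a
  refine ((hH1.add hH2).add integrable_inv_one_add_sq).mono' ?_ (Eventually.of_forall fun t => ?_)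
  · exact Measurable.aestronglyMeasurable (by fun_prop)
  · have h0 : ∀ s, 0 ≤ H s := fun s => Set.indicator_nonneg (fun x hx => Real.rpow_nonneg hx.1.le _) s
    have h1 : ∀ s, 0 < s → s ≤ 1 → H s = (√s)⁻¹ := by
      intro s hs hs1
      have : s ∈ Set.Ioc (0 : ℝ) 1 := ⟨hs, hs1⟩
      simp only [H, Set.indicator_of_mem this]
      rw [Real.rpow_neg hs.le, Real.sqrt_eq_rpow]
    have hb : (1 + t ^ 2)⁻¹ ≤ 1 := inv_le_one_of_one_le₀ (by nlinarith [sq_nonneg t])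
    have hb0 : 0 < (1 + t ^ 2)⁻¹ := by positivity
    rw [Real.norm_of_nonneg (by positivity)]
    simp only [Pi.add_apply]
    have g1 := h0 (t - a)
    have g2 := h0 (-(t - a))
    rcases lt_or_ge 1 |t - a| with h | h
    · have : (√|t - a|)⁻¹ ≤ 1 := inv_le_one_of_one_le₀ (by
        rw [Real.one_le_sqrt]; exact h.le)
      nlinarith
    · have : (√|t - a|)⁻¹ * (1 + t ^ 2)⁻¹ ≤ (√|t - a|)⁻¹ :=
        mul_le_of_le_one_right (by positivity) hb
      rcases lt_trichotomy (t - a) 0 with h2 | h2 | h2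
      · rw [abs_of_neg h2] at *
        rw [h1 (-(t - a)) (by linarith) h]
        linarith
      · rw [h2]
        simp only [abs_zero, Real.sqrt_zero, inv_zero, zero_mul]
        rw [h2] at g1 g2
        linarith
      · rw [abs_of_pos h2] at *
        rw [h1 (t - a) h2 h]
        linarith

theorem sqrt_int2 (ξ : ℝ) (hξ : ξ ≠ 0) :
    Integrable fun u : ℝ => (√|ξ - u ^ 2|)⁻¹ * (1 + u ^ 2)⁻¹ := by
  rcases lt_or_gt_of_ne hξ with h | h
  · refine (integrable_inv_one_add_sq.const_mul ((√|ξ|)⁻¹)).mono'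
      (Measurable.aestronglyMeasurable (by fun_prop)) (Eventually.of_forall fun u => ?_)
    rw [Real.norm_of_nonneg (by positivity)]
    have : 0 < √|ξ| := Real.sqrt_pos.mpr (abs_pos.mpr hξ)
    have h3 : |ξ| ≤ |ξ - u ^ 2| := by
      rw [abs_of_neg h, abs_of_neg (by nlinarith [sq_nonneg u])]
      nlinarith [sq_nonneg u]
    gcongr
  · set a := √ξ with ha
    have ha0 : 0 < a := Real.sqrt_pos.mpr h
    have haa : ξ = a ^ 2 := (Real.sq_sqrt h.le).symm
    refine (((sqrt_int a).add (sqrt_int (-a))).const_mul ((√a)⁻¹)).mono'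
      (Measurable.aestronglyMeasurable (by fun_prop)) (Eventually.of_forall fun u => ?_)
    rw [Real.norm_of_nonneg (by positivity)]
    have e : |ξ - u ^ 2| = |u - a| * |u - -a| := by
      rw [haa, ← abs_mul, abs_sub_comm]; congr 1; ring
    rw [e, Real.sqrt_mul (abs_nonneg _), mul_inv]
    simp only [Pi.add_apply]
    rw [← add_mul, ← mul_assoc]
    refine mul_le_mul_of_nonneg_right ?_ (by positivity)
    have hsa : 0 < √a := Real.sqrt_pos.mpr ha0
    have k1 : 0 ≤ (√|u - a|)⁻¹ := by positivity
    have k2 : 0 ≤ (√|u - -a|)⁻¹ := by positivity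
    have k3 : 0 < (√a)⁻¹ := by positivity
    rcases le_or_gt 0 u with hu | hu
    · have : (√|u - -a|)⁻¹ ≤ (√a)⁻¹ := by
        gcongr
        rw [abs_of_pos (by linarith)]; linarith
      nlinarith
    · have : (√|u - a|)⁻¹ ≤ (√a)⁻¹ := by
        gcongr
        rw [abs_of_neg (by linarith)]; linarith
      nlinarith

theorem ae_fst_ne : ∀ᵐ q : ℝ × ℝ, q.1 ≠ 0 := by
  have : ∀ᵐ t : ℝ, t ≠ 0 := Measure.ae_ne volume 0
  exact Measure.quasiMeasurePreserving_fst.ae this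

theorem ae_snd_sq_ne (ξ : ℝ) : ∀ᵐ q : ℝ × ℝ, ξ - q.2 ^ 2 ≠ 0 := by
  have : ∀ᵐ t : ℝ, ξ - t ^ 2 ≠ 0 := by
    filter_upwards [Measure.ae_ne volume (√ξ), Measure.ae_ne volume (-√ξ)] with t h1 h2 h
    have : ξ = t ^ 2 := by linarith
    rw [this, Real.sqrt_sq_eq_abs] at h1 h2
    rcases abs_choice t with h | h <;> rw [h] at h1 h2
    · exact h1 rfl
    · simp at h2
  exact Measure.quasiMeasurePreserving_snd.ae this

theorem rpow_n (n : ℕ) (t : ℝ) (ht : t ≠ 0) : |t| ^ ((n : ℝ) - 1) = |t| ^ n / |t| := by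
  rw [Real.rpow_sub_one (abs_ne_zero.mpr ht), Real.rpow_natCast]

theorem K_meas (n : ℕ) (Φ : SchwartzMap (ℝ × ℝ × ℝ) ℂ) :
    Measurable fun x : ℝ × (ℝ × ℝ) => Φ (x.2.2, (x.1 - x.2.2 ^ 2) / x.2.1, x.2.1) *
      ((|x.2.1| ^ ((n : ℝ) - 1) : ℝ) : ℂ) := by
  have := Φ.continuous.measurable
  fun_prop

theorem slice_int (n : ℕ) (Φ : SchwartzMap (ℝ × ℝ × ℝ) ℂ) (ξ : ℝ) (hξ : ξ ≠ 0) :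
    Integrable fun q : ℝ × ℝ => Φ (q.2, (ξ - q.2 ^ 2) / q.1, q.1) *
      ((|q.1| ^ ((n : ℝ) - 1) : ℝ) : ℂ) := by
  obtain ⟨C, hC, hb⟩ := schw_bound Φ (n + 5)
  have hd : Integrable fun q : ℝ × ℝ => C * (((√|q.1 - 0|)⁻¹ * (1 + q.1 ^ 2)⁻¹) *
      ((√|ξ - q.2 ^ 2|)⁻¹ * (1 + q.2 ^ 2)⁻¹)) :=
    ((sqrt_int 0).mul_prod (sqrt_int2 ξ hξ)).const_mul C
  refine hd.mono' ?_ ?_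
  · exact ((K_meas n Φ).comp (measurable_prodMk_left (x := ξ))).aestronglyMeasurable
  · filter_upwards [ae_fst_ne, ae_snd_sq_ne ξ] with q h1 h2
    obtain ⟨t, u⟩ := q
    simp only at h1 h2 ⊢
    rw [sub_zero, norm_mul, Complex.norm_real, Real.norm_of_nonneg (by positivity), rpow_n n t h1]
    set v := (ξ - u ^ 2) / t with hv
    have hb1 := hb (u, v, t)
    set P := ‖Φ (u, v, t)‖ with hP
    set R := ‖((u, v, t) : ℝ × ℝ × ℝ)‖ with hR
    have hR0 : 0 ≤ R := norm_nonneg _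
    have ru : |u| ≤ R := norm_fst_le (u, v, t)
    have rv : |v| ≤ R := (norm_fst_le (v, t)).trans (norm_snd_le (u, v, t))
    have rt : |t| ≤ R := (norm_snd_le (v, t)).trans (norm_snd_le (u, v, t))
    have a1 : √|v| ≤ 1 + R := by
      rw [Real.sqrt_le_left (by positivity)]; nlinarith
    have a2 : 1 + u ^ 2 ≤ (1 + R) ^ 2 := by
      rw [← sq_abs]; nlinarith [abs_nonneg u]
    have a3 : 1 + t ^ 2 ≤ (1 + R) ^ 2 := by
      rw [← sq_abs]; nlinarith [abs_nonneg t]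
    have a4 : |t| ^ n ≤ (1 + R) ^ n := by gcongr; linarith
    have b : (√|v| * (1 + u ^ 2) * (1 + t ^ 2) * |t| ^ n) * P ≤ C := by
      refine le_trans ?_ hb1
      gcongr
      calc _ ≤ (1 + R) * (1 + R) ^ 2 * (1 + R) ^ 2 * (1 + R) ^ n := by gcongr
        _ = _ := by ring
    have ht : 0 < |t| := abs_pos.mpr h1
    have hst : 0 < √|t| := Real.sqrt_pos.mpr ht
    have hsx : 0 < √|ξ - u ^ 2| := Real.sqrt_pos.mpr (abs_pos.mpr h2)
    have hsv : √|v| = √|ξ - u ^ 2| / √|t| := by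
      rw [hv, abs_div, Real.sqrt_div (abs_nonneg _)]
    have hss : √|t| * √|t| = |t| := Real.mul_self_sqrt ht.le
    rw [hsv] at b
    have hX : P * (|t| ^ n / |t|) = (√|ξ - u ^ 2| / √|t| * (1 + u ^ 2) * (1 + t ^ 2) * |t| ^ n * P)
        * ((√|t|)⁻¹ * (1 + t ^ 2)⁻¹ * ((√|ξ - u ^ 2|)⁻¹ * (1 + u ^ 2)⁻¹)) := by
      have : (1 + u ^ 2) ≠ 0 := by positivity
      have : (1 + t ^ 2) ≠ 0 := by positivity
      have e5 : |t| ^ n / |t| = |t| ^ n / (√|t| * √|t|) := by rw [hss]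
      rw [e5]
      field_simp
    rw [hX]
    gcongr

theorem subst_int (f : ℝ → ℂ) (a t : ℝ) : ∫ ξ, f ((ξ - a) / t) = ((|t| : ℝ) : ℂ) * ∫ v, f v := by
  rw [integral_sub_right_eq_self (fun ξ => f (ξ / t)) a, Measure.integral_comp_div]
  simp

/-- Φ with coordinates rearranged -/
def reo : ((ℝ × ℝ) × ℝ) ≃L[ℝ] (ℝ × ℝ × ℝ) :=
  (LinearEquiv.toContinuousLinearEquiv
    { toFun := fun x => (x.1.1, x.2, x.1.2)
      invFun := fun x => ((x.1, x.2.2), x.2.1)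
      map_add' := fun _ _ => rfl
      map_smul' := fun _ _ => rfl
      left_inv := fun _ => rfl
      right_inv := fun _ => rfl })

theorem reo_apply (u t v : ℝ) : reo ((u, t), v) = (u, v, t) := rfl

theorem wt_int (n : ℕ) (Φ : SchwartzMap (ℝ × ℝ × ℝ) ℂ) :
    Integrable fun x : (ℝ × ℝ) × ℝ => ((|x.1.2| ^ n : ℝ) : ℂ) * Φ (x.1.1, x.2, x.1.2) := by
  refine wint (sc reo Φ) n (fun x => ((|x.1.2| ^ n : ℝ) : ℂ)) (by fun_prop) 1 (fun x => ?_)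
  rw [Complex.norm_real, norm_pow, Real.norm_eq_abs, abs_abs, one_mul]
  gcongr
  exact (norm_snd_le x.1).trans (norm_fst_le x)

theorem K_int (n : ℕ) (Φ : SchwartzMap (ℝ × ℝ × ℝ) ℂ) :
    Integrable fun x : ℝ × (ℝ × ℝ) => Φ (x.2.2, (x.1 - x.2.2 ^ 2) / x.2.1, x.2.1) *
      ((|x.2.1| ^ ((n : ℝ) - 1) : ℝ) : ℂ) := by
  rw [Measure.volume_eq_prod, integrable_prod_iff' (K_meas n Φ).aestronglyMeasurable]
  have hw := wt_int n Φ
  rw [Measure.volume_eq_prod] at hw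
  have hsl : ∀ u t, Integrable fun v => Φ (u, v, t) := by
    intro u t
    exact (slice (sc reo Φ) (u, t)).integrable
  constructor
  · filter_upwards [ae_fst_ne] with q hq
    have := ((hsl q.2 q.1).comp_div hq).comp_sub_right (q.2 ^ 2)
    exact this.mul_const _
  · have h2 := hw.norm.integral_prod_left.swap
    refine h2.congr ?_
    filter_upwards [ae_fst_ne] with q hq
    obtain ⟨t, u⟩ := q
    simp only [Function.comp_apply, Prod.swap_prod_mk, norm_mul, Complex.norm_real,
      integral_const_mul, integral_mul_const] at hq ⊢
    have e := integral_sub_right_eq_self (fun ξ => ‖Φ (u, ξ / t, t)‖) (u ^ 2) (μ := volume)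
    rw [e, Measure.integral_comp_div (fun ξ => ‖Φ (u, ξ, t)‖) t, rpow_n n t hq]
    have : 0 < |t| := abs_pos.mpr hq
    simp only [norm_pow, norm_div, Real.norm_eq_abs, abs_abs, smul_eq_mul]
    field_simp

theorem h_eq (n : ℕ) (Φ : SchwartzMap (ℝ × ℝ × ℝ) ℂ) (ξ : ℝ) (hξ : ξ ≠ 0) :
    (∫ t in ({0}ᶜ : Set ℝ), ∫ u : ℝ,
      Φ (u, (ξ - u ^ 2) / t, t) * ((|t| ^ ((n : ℝ) - 1) : ℝ) : ℂ)) =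
    ∫ q : ℝ × ℝ, Φ (q.2, (ξ - q.2 ^ 2) / q.1, q.1) * ((|q.1| ^ ((n : ℝ) - 1) : ℝ) : ℂ) := by
  rw [restrict_compl_singleton, Measure.volume_eq_prod, integral_prod _ (slice_int n Φ ξ hξ)]

theorem h_int (n : ℕ) (Φ : SchwartzMap (ℝ × ℝ × ℝ) ℂ) :
    Integrable fun ξ : ℝ => ∫ t in ({0}ᶜ : Set ℝ), ∫ u : ℝ,
      Φ (u, (ξ - u ^ 2) / t, t) * ((|t| ^ ((n : ℝ) - 1) : ℝ) : ℂ) := by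
  have := (K_int n Φ).integral_prod_left
  refine this.congr ?_
  filter_upwards [Measure.ae_ne volume 0] with ξ hξ
  exact (h_eq n Φ ξ hξ).symm

theorem h_main (n : ℕ) (Φ : SchwartzMap (ℝ × ℝ × ℝ) ℂ)
    (g : ℝ → ℂ) (hg : Continuous g) (hs : HasCompactSupport g) :
    ∫ ξ : ℝ, g ξ * (∫ t in ({0}ᶜ : Set ℝ), ∫ u : ℝ,
      Φ (u, (ξ - u ^ 2) / t, t) * ((|t| ^ ((n : ℝ) - 1) : ℝ) : ℂ)) =
    ∫ x : (ℝ × ℝ) × ℝ, g (x.1.1 ^ 2 + inner ℝ x.2 x.1.2) *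
        (((|x.1.2| ^ n : ℝ) : ℂ) * sc reo Φ x) := by
  obtain ⟨M, hM⟩ := hg.bounded_above_of_compact_support hs
  have i1 : Integrable fun x : ℝ × (ℝ × ℝ) => g x.1 *
      (Φ (x.2.2, (x.1 - x.2.2 ^ 2) / x.2.1, x.2.1) * ((|x.2.1| ^ ((n : ℝ) - 1) : ℝ) : ℂ)) :=
    (K_int n Φ).bdd_mul (c := M) (hg.comp continuous_fst).aestronglyMeasurable
      (Eventually.of_forall fun _ => hM _)
  have i2 : Integrable fun x : (ℝ × ℝ) × ℝ => g (x.1.1 ^ 2 + inner ℝ x.2 x.1.2) *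
        (((|x.1.2| ^ n : ℝ) : ℂ) * sc reo Φ x) :=
    (wt_int n Φ).bdd_mul (c := M) (Continuous.aestronglyMeasurable (by fun_prop))
      (Eventually.of_forall fun _ => hM _)
  calc _ = ∫ ξ : ℝ, ∫ q : ℝ × ℝ, g ξ * (Φ (q.2, (ξ - q.2 ^ 2) / q.1, q.1) *
        ((|q.1| ^ ((n : ℝ) - 1) : ℝ) : ℂ)) := by
        refine integral_congr_ae ?_
        filter_upwards [Measure.ae_ne volume 0] with ξ hξ
        rw [h_eq n Φ ξ hξ, integral_const_mul]
    _ = ∫ q : ℝ × ℝ, ∫ ξ : ℝ, g ξ * (Φ (q.2, (ξ - q.2 ^ 2) / q.1, q.1) *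
        ((|q.1| ^ ((n : ℝ) - 1) : ℝ) : ℂ)) := integral_integral_swap i1
    _ = ∫ q : ℝ × ℝ, ∫ v : ℝ, g (q.2 ^ 2 + inner ℝ v q.1) *
        (((|q.1| ^ n : ℝ) : ℂ) * Φ (q.2, v, q.1)) := by
        refine integral_congr_ae ?_
        filter_upwards [ae_fst_ne] with q hq
        have e := subst_int (fun v => g (q.2 ^ 2 + q.1 * v) * Φ (q.2, v, q.1)) (q.2 ^ 2) q.1
        have e1 : ∀ ξ, q.2 ^ 2 + q.1 * ((ξ - q.2 ^ 2) / q.1) = ξ := fun ξ => by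
          field_simp; ring
        simp only [e1] at e
        simp only [← mul_assoc, integral_mul_const, e]
        rw [rpow_n n _ hq]
        have : ((|q.1| : ℝ) : ℂ) ≠ 0 := by exact_mod_cast abs_ne_zero.mpr hq
        rw [← integral_const_mul, ← integral_mul_const]
        congr 1
        funext v
        have e3 : inner ℝ v q.1 = q.1 * v := by simp [inner]
        rw [e3]
        push_cast
        field_simp
    _ = ∫ q : ℝ × ℝ, ∫ v : ℝ, g (q.1 ^ 2 + inner ℝ v q.2) *
        (((|q.2| ^ n : ℝ) : ℂ) * Φ (q.1, v, q.2)) := by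
        rw [Measure.volume_eq_prod]
        exact integral_prod_swap (fun q : ℝ × ℝ => ∫ v : ℝ, g (q.1 ^ 2 + inner ℝ v q.2) *
          (((|q.2| ^ n : ℝ) : ℂ) * Φ (q.1, v, q.2)))
    _ = _ := by
        rw [Measure.volume_eq_prod (ℝ × ℝ) ℝ, integral_prod _ i2]
        rfl
end part9

section coord
variable (m : ℕ)

/-- the coordinate map -/
def cmap : (Fin (2 * m + 1) → ℝ) →ₗ[ℝ] (ℝ × EuclideanSpace ℝ (Fin m)) × EuclideanSpace ℝ (Fin m) where
  toFun x := ((x 0, WithLp.toLp 2 fun i : Fin m => x ⟨2 * i.1 + 2, by omega⟩),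
    WithLp.toLp 2 fun i : Fin m => x ⟨2 * i.1 + 1, by omega⟩)
  map_add' _ _ := rfl
  map_smul' _ _ := rfl

theorem cmap_inj : Function.Injective (cmap m) := by
  intro x y h
  have h0 : x 0 = y 0 := congrArg (fun z => z.1.1) h
  have h1 : ∀ i : Fin m, x ⟨2 * i.1 + 2, by omega⟩ = y ⟨2 * i.1 + 2, by omega⟩ :=
    fun i => congrArg (fun z => z.1.2 i) h
  have h2 : ∀ i : Fin m, x ⟨2 * i.1 + 1, by omega⟩ = y ⟨2 * i.1 + 1, by omega⟩ :=
    fun i => congrArg (fun z => z.2 i) h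
  funext ⟨j, hj⟩
  rcases Nat.even_or_odd' j with ⟨k, rfl | rfl⟩
  · rcases k with _ | k
    · exact h0
    · exact h1 ⟨k, by omega⟩
  · exact h2 ⟨k, by omega⟩

/-- the coordinate equivalence -/
def ceq : (Fin (2 * m + 1) → ℝ) ≃L[ℝ]
    (ℝ × EuclideanSpace ℝ (Fin m)) × EuclideanSpace ℝ (Fin m) :=
  (LinearEquiv.ofInjectiveOfFinrankEq (cmap m) (cmap_inj m) (by simp; omega)).toContinuousLinearEquiv

theorem ceq_apply (x) : ceq m x = cmap m x := rfl

theorem splitQR_eq (x : Fin (2 * m + 1) → ℝ) :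
    splitQR (2 * m + 1) x = (ceq m x).1.1 ^ 2 + inner ℝ (ceq m x).2 (ceq m x).1.2 := by
  have h : ¬ Even (2 * m + 1) := by simp
  have h2 : (2 * m + 1) / 2 = m := by omega
  rw [splitQR, if_neg h, h2, ceq_apply, Finset.sum_range]
  congr 1
  rw [PiLp.inner_apply]
  refine Finset.sum_congr rfl fun i _ => ?_
  have h3 : 2 * i.1 + 1 < 2 * m + 1 := by omega
  have h4 : 2 * i.1 + 2 < 2 * m + 1 := by omega
  simp only [padR, dif_pos h3, dif_pos h4, cmap]
  simp [inner, mul_comm]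

theorem coord_int : ∃ c : ℂ, c ≠ 0 ∧
    ∀ f : (ℝ × EuclideanSpace ℝ (Fin m)) × EuclideanSpace ℝ (Fin m) → ℂ,
      ∫ x, f (ceq m x) = c * ∫ y, f y := by
  let e := ceq m
  have : (Measure.map e (volume : Measure (Fin (2 * m + 1) → ℝ))).IsAddHaarMeasure :=
    ContinuousLinearEquiv.isAddHaarMeasure_map e volume
  let μ' := Measure.map e (volume : Measure (Fin (2 * m + 1) → ℝ))
  have hc := Measure.isAddLeftInvariant_eq_smul μ' volume
  have h0 := Measure.addHaarScalarFactor_pos_of_isAddHaarMeasure μ' volume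
  set c := Measure.addHaarScalarFactor μ' volume
  refine ⟨((c : ℝ) : ℂ), ?_, fun f => ?_⟩
  · exact_mod_cast h0.ne'
  · have := e.toHomeomorph.measurableEmbedding.integral_map (μ := volume) f
    change ∫ y, f y ∂μ' = ∫ x, f (e x) at this
    rw [hc, integral_smul_nnreal_measure] at this
    rw [← this, NNReal.smul_def, Complex.real_smul]

end coord

theorem hThreeR_eq (m : ℕ) (hm : 1 ≤ m) (Φ₂ : SchwartzMap (ℝ × ℝ × ℝ) ℂ) (ξ : ℝ) :
    hThreeR (2 * m + 1) Φ₂ ξ = ∫ t in ({0}ᶜ : Set ℝ), ∫ u : ℝ,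
      Φ₂ (u, (ξ - u ^ 2) / t, t) * ((|t| ^ (((m - 1 : ℕ) : ℝ) - 1) : ℝ) : ℂ) := by
  have : (((2 * m + 1 : ℕ) : ℝ) - 5) / 2 = ((m - 1 : ℕ) : ℝ) - 1 := by
    push_cast [hm]; ring
  rw [hThreeR, this]

theorem main_id (m : ℕ) (hm : 1 ≤ m) (c : ℂ)
    (hc : ∀ f : (ℝ × EuclideanSpace ℝ (Fin m)) × EuclideanSpace ℝ (Fin m) → ℂ,
      ∫ x, f (ceq m x) = c * ∫ y, f y)
    (Φ : SchwartzMap (Fin (2 * m + 1) → ℝ) ℂ) (Φ₂ : SchwartzMap (ℝ × ℝ × ℝ) ℂ)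
    (h : Mat (c • sc (ceq m).symm Φ) (sc reo Φ₂))
    (g : ℝ → ℂ) (hg : Continuous g) (hs : HasCompactSupport g) :
    ∫ x : Fin (2 * m + 1) → ℝ, g (splitQR (2 * m + 1) x) * Φ x =
      ∫ ξ : ℝ, g ξ * hThreeR (2 * m + 1) Φ₂ ξ := by
  have : Nonempty (Fin m) := ⟨⟨0, hm⟩⟩
  have hk := key_cc _ _ h g hg hs
  rw [finrank_euclideanSpace_fin, ← h_main (m - 1) Φ₂ g hg hs] at hk
  simp only [hThreeR_eq m hm]
  rw [← hk]
  simp only [smul_apply, smul_eq_mul, mul_left_comm _ c, integral_const_mul]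
  rw [← hc]
  congr 1
  funext x
  rw [splitQR_eq, sc_apply, ContinuousLinearEquiv.symm_apply_apply]

/-- real, odd-dimensional case of the reduction of pushforwards under
the split quadratic form in `d` variables to twisted pushforwards in `3` variables. -/
theorem pushforward_eq_twisted_pushforward_real_odd (d : ℕ) (hd : 3 ≤ d) (hdo : Odd d) :
    (∀ Φ₂ : SchwartzMap (ℝ × ℝ × ℝ) ℂ,
      (∀ ξ : ℝ, ξ ≠ 0 → IntegrableOn
          (fun q : ℝ × ℝ =>
            Φ₂ (q.2, (ξ - q.2 ^ 2) / q.1, q.1) * ((|q.1| ^ (((d : ℝ) - 5) / 2) : ℝ) : ℂ))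
          (({0}ᶜ : Set ℝ) ×ˢ (Set.univ : Set ℝ))) ∧
      LocallyIntegrable (hThreeR d Φ₂) volume) ∧
    (∀ Φ : SchwartzMap (Fin d → ℝ) ℂ, ∃ Φ₂ : SchwartzMap (ℝ × ℝ × ℝ) ℂ,
      ∀ g : ℝ → ℂ, Continuous g → HasCompactSupport g →
        ∫ x : Fin d → ℝ, g (splitQR d x) * Φ x = ∫ ξ : ℝ, g ξ * hThreeR d Φ₂ ξ) ∧
    (∀ Φ₂ : SchwartzMap (ℝ × ℝ × ℝ) ℂ, ∃ Φ : SchwartzMap (Fin d → ℝ) ℂ,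
      ∀ g : ℝ → ℂ, Continuous g → HasCompactSupport g →
        ∫ x : Fin d → ℝ, g (splitQR d x) * Φ x = ∫ ξ : ℝ, g ξ * hThreeR d Φ₂ ξ) := by
  obtain ⟨m, rfl⟩ := hdo
  have hm : 1 ≤ m := by omega
  have : Nonempty (Fin m) := ⟨⟨0, hm⟩⟩
  have hp : (((2 * m + 1 : ℕ) : ℝ) - 5) / 2 = ((m - 1 : ℕ) : ℝ) - 1 := by
    push_cast [hm]; ring
  obtain ⟨c, hc0, hc⟩ := coord_int m
  refine ⟨fun Φ₂ => ⟨fun ξ hξ => ?_, ?_⟩, fun Φ => ?_, fun Φ₂ => ?_⟩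
  · rw [hp]
    exact (slice_int (m - 1) Φ₂ ξ hξ).integrableOn
  · have : hThreeR (2 * m + 1) Φ₂ = _ := funext fun ξ => hThreeR_eq m hm Φ₂ ξ
    rw [this]
    exact (h_int (m - 1) Φ₂).locallyIntegrable
  · obtain ⟨φ₂, h⟩ := mat_ex1 (c • sc (ceq m).symm Φ)
    have e : sc reo (sc reo.symm φ₂) = φ₂ := by
      ext x; simp only [sc_apply, ContinuousLinearEquiv.symm_apply_apply]
    refine ⟨sc reo.symm φ₂, fun g hg hs => main_id m hm c hc Φ _ ?_ g hg hs⟩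
    rw [e]
    exact h
  · obtain ⟨φ, h⟩ := mat_ex2 (E := EuclideanSpace ℝ (Fin m)) (sc reo Φ₂)
    have e : c • sc (ceq m).symm (sc (ceq m) (c⁻¹ • φ)) = φ := by
      ext x
      simp only [smul_apply, sc_apply, ContinuousLinearEquiv.apply_symm_apply, smul_eq_mul]
      field_simp
    refine ⟨sc (ceq m) (c⁻¹ • φ), fun g hg hs => main_id m hm c hc _ Φ₂ ?_ g hg hs⟩
    rw [e]
    exact h
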